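/- There exists a group Γ' with unsolvable word problem admitting a finite presentation with 5 generators a, b, c, d, e and 12 relators, in which the images d̄ and ē of the generators d and e in the abelianization Γ'/[Γ',Γ'] have finite orders dividing 3 and 4 respectively; in particular, this presentation satisfies condition (2.1) since gcd(3,4) = 1. -/

import Mathlib

namespace WP

/-! ### Part A : the binary queue system and its free-group shadow -/

section PartA

variable {R K : Type*} [CommRing R] [CommRing K] [DecidableEq R]

/-- the block appended when an `exec` letter is read in phase `S` -/
def vblock (o : List R) (S : R) : List Bool := o.map (fun a => decide (S + a = 0))

/-- the output of a letter -/
def vout (o : List R) (h : Bool) (S : R) : List Bool := if h then vblock o S else []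

/-- the binary queue system reaches the empty queue in a phase satisfying `T` -/
inductive VTo (o : List R) (T : R → Prop) : List Bool → R → Prop
  | nil (S : R) : T S → VTo o T [] S
  | step (h : Bool) (w : List Bool) (S : R) :
      VTo o T (w ++ vout o h S) (S + 1) → VTo o T (h :: w) S

/-- number of sign changes, starting from sign `b` -/
def rf : Bool → List Bool → ℕ
  | _, [] => 0
  | b, x :: l => if x = b then rf b l else 1 + rf x l

lemma rf_le_succ (b x : Bool) (l : List Bool) : rf b l ≤ 1 + rf x l := by
  cases l with
  | nil => simp [rf]
  | cons y l => simp only [rf]; cases b <;> cases x <;> cases y <;> simp <;> omega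

lemma rf_mono {l₁ l₂ : List Bool} (h : l₁.Sublist l₂) : ∀ b, rf b l₁ ≤ rf b l₂ := by
  induction h with
  | slnil => intro b; simp
  | cons a _ ih =>
    intro b
    simp only [rf]
    split_ifs with h
    · exact ih b
    · exact (rf_le_succ b a _).trans (by have := ih a; omega)
  | cons_cons a _ ih =>
    intro b
    simp only [rf]
    split_ifs with h
    · exact ih b
    · have := ih a; omega

lemma rf_replicate_same (b : Bool) (k : ℕ) (l : List Bool) :
    rf b (List.replicate k b ++ l) = rf b l := by
  induction k with
  | zero => simp
  | succ k ih => simp [List.replicate_succ, rf, ih]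

lemma rf_replicate_le (b x : Bool) (k : ℕ) (l : List Bool) :
    rf b (List.replicate k x ++ l) ≤ rf b (x :: l) := by
  by_cases h : x = b
  · subst h; rw [rf_replicate_same]; simp [rf]
  · cases k with
    | zero => simp only [rf, h, if_false, List.replicate_zero, List.nil_append]; exact rf_le_succ _ _ _
    | succ k => simp [List.replicate_succ, rf, h, rf_replicate_same]

def posL (w : List Bool) : List (Bool × Bool) := w.map (fun x => (x, true))
def negL (w : List Bool) : List (Bool × Bool) := w.reverse.map (fun x => (x, false))

@[simp] lemma posL_nil : posL [] = [] := rfl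
@[simp] lemma negL_nil : negL [] = [] := rfl
lemma posL_append (a b) : posL (a ++ b) = posL a ++ posL b := by simp [posL]
lemma negL_append (a b) : negL (a ++ b) = negL b ++ negL a := by simp [negL]
lemma posL_cons (x a) : posL (x :: a) = (x, true) :: posL a := by simp [posL]
lemma negL_cons (x a) : negL (x :: a) = negL a ++ [(x, false)] := by simp [negL]

lemma mk_negL (w : List Bool) : FreeGroup.mk (negL w) = (FreeGroup.mk (posL w))⁻¹ := by
  rw [FreeGroup.inv_mk]
  simp only [FreeGroup.invRev, negL, posL, List.map_map, List.map_reverse]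
  rfl

lemma snd_posL (w : List Bool) : (posL w).map Prod.snd = List.replicate w.length true := by
  induction w with
  | nil => rfl
  | cons x w ih => simp [posL_cons, ih, List.replicate_succ]

lemma snd_negL (w : List Bool) : (negL w).map Prod.snd = List.replicate w.length false := by
  rw [List.eq_replicate_iff]
  simp [negL]

/-- unreduced output word along `γ` -/
def Hl (o : List R) : R → List (Bool × Bool) → List (Bool × Bool)
  | _, [] => []
  | S, (x, true) :: γ => posL (vout o x S) ++ Hl o (S + 1) γ
  | S, (x, false) :: γ => negL (vout o x (S - 1)) ++ Hl o (S - 1) γ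

lemma rf_Hl (o : List R) (γ : List (Bool × Bool)) :
    ∀ (S : R) (b : Bool), rf b ((Hl o S γ).map Prod.snd) ≤ rf b (γ.map Prod.snd) := by
  induction γ with
  | nil => intro S b; simp [Hl]
  | cons p γ ih =>
    intro S b
    obtain ⟨x, s⟩ := p
    have key : ∀ (c : Bool) (l m : List Bool) (_ : ∀ b, rf b l ≤ rf b m), rf b (c :: l) ≤ rf b (c :: m) := by
      intro c l m h
      simp only [rf]; split_ifs
      · exact h b
      · have := h c; omega
    cases s
    · simp only [Hl, List.map_append, snd_negL, List.map_cons]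
      exact (rf_replicate_le _ _ _ _).trans (key _ _ _ (fun b => ih _ b))
    · simp only [Hl, List.map_append, snd_posL, List.map_cons]
      exact (rf_replicate_le _ _ _ _).trans (key _ _ _ (fun b => ih _ b))

/-- outputs of the positive word `δ` starting in phase `S` -/
def vouts (o : List R) : R → List Bool → List Bool
  | _, [] => []
  | S, x :: δ => vout o x S ++ vouts o (S + 1) δ

lemma vouts_concat (o : List R) (δ : List Bool) (x : Bool) : ∀ S,
    vouts o S (δ ++ [x]) = vouts o S δ ++ vout o x (S + δ.length) := by
  induction δ with
  | nil => intro S; simp [vouts]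
  | cons y δ ih =>
    intro S
    simp only [List.cons_append, vouts, ih, List.append_assoc, List.length_cons, Nat.cast_add, Nat.cast_one]
    rw [add_assoc, add_comm (1 : R)]

lemma Hl_negL (o : List R) (δ : List Bool) (γ : List (Bool × Bool)) : ∀ S,
    Hl o S (negL δ ++ γ) = negL (vouts o (S - δ.length) δ) ++ Hl o (S - δ.length) γ := by
  induction δ using List.reverseRecOn with
  | nil => intro S; simp [vouts]
  | append_singleton δ x ih =>
    intro S
    rw [negL_append, negL_cons, vouts_concat, negL_append]
    simp only [negL_nil, List.nil_append, List.cons_append, Hl, ih, List.length_append, List.length_cons, List.length_nil, Nat.cast_add, Nat.cast_one, List.append_assoc]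
    have e1 : S - (↑δ.length + ((0 : ℕ) + 1 : R)) + δ.length = S - 1 := by push_cast; ring
    have e2 : S - (↑δ.length + ((0 : ℕ) + 1 : R)) = S - 1 - δ.length := by push_cast; ring
    rw [e1, e2]

lemma exists_neg_start (γ : List (Bool × Bool)) :
    ∃ δ γ', γ = negL δ ++ γ' ∧ ∀ p ∈ γ'.head?, p.2 = true := by
  induction γ with
  | nil => exact ⟨[], [], rfl, by simp⟩
  | cons p γ ih =>
    obtain ⟨x, s⟩ := p
    cases s
    · obtain ⟨δ, γ', h, h'⟩ := ih
      refine ⟨δ ++ [x], γ', ?_, h'⟩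
      rw [negL_append, h]; simp [negL_cons]
    · exact ⟨[], (x, true) :: γ, rfl, by simp⟩

lemma common_start (A : List Bool) : ∀ N : List Bool,
    ∃ a b r, A = r ++ a ∧ N = r ++ b ∧ ∀ x ∈ a.head?, ∀ y ∈ b.head?, x ≠ y := by
  induction A with
  | nil => intro N; exact ⟨[], N, [], by simp⟩
  | cons x A ih =>
    intro N
    cases N with
    | nil => exact ⟨x :: A, [], [], by simp⟩
    | cons y N =>
      by_cases h : x = y
      · subst h
        obtain ⟨a, b, r, h1, h2, h3⟩ := ih N
        exact ⟨a, b, x :: r, by simp [h1], by simp [h2], h3⟩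
      · exact ⟨x :: A, y :: N, [], by simp, by simp, by simpa using h⟩

lemma common_suffix (A N : List Bool) :
    ∃ a b r, A = a ++ r ∧ N = b ++ r ∧ ∀ x ∈ a.getLast?, ∀ y ∈ b.getLast?, x ≠ y := by
  obtain ⟨a, b, r, h1, h2, h3⟩ := common_start A.reverse N.reverse
  refine ⟨a.reverse, b.reverse, r.reverse, ?_, ?_, ?_⟩
  · rw [← List.reverse_append, ← h1, List.reverse_reverse]
  · rw [← List.reverse_append, ← h2, List.reverse_reverse]
  · simpa using h3

lemma sublist_of_mk_eq {L₁ L₂ : List (Bool × Bool)} (h : FreeGroup.IsReduced L₁)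
    (e : FreeGroup.mk L₁ = FreeGroup.mk L₂) : L₁.Sublist L₂ := by
  have h1 : FreeGroup.reduce L₁ = L₁ := FreeGroup.isReduced_iff_reduce_eq.mp h
  have h2 : FreeGroup.reduce L₁ = FreeGroup.reduce L₂ := FreeGroup.reduce.sound e
  rw [← h1, h2]
  exact FreeGroup.reduce.red.sublist

lemma isReduced_of_const (l : List (Bool × Bool)) (b : Bool) (h : ∀ p ∈ l, p.2 = b) :
    FreeGroup.IsReduced l := by
  unfold FreeGroup.IsReduced
  induction l with
  | nil => simp
  | cons x l ih =>
    rw [List.isChain_cons]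
    refine ⟨?_, ih (fun p hp => h p (by simp [hp]))⟩
    intro y hy _
    rw [h x (by simp), h y (by simp [List.mem_of_mem_head? hy])]

lemma isReduced_negL (w : List Bool) : FreeGroup.IsReduced (negL w) :=
  isReduced_of_const _ false (by simp [negL])
lemma isReduced_posL (w : List Bool) : FreeGroup.IsReduced (posL w) :=
  isReduced_of_const _ true (by simp [posL])

lemma isReduced_append {l m : List (Bool × Bool)} (hl : FreeGroup.IsReduced l)
    (hm : FreeGroup.IsReduced m)
    (h : ∀ x ∈ l.getLast?, ∀ y ∈ m.head?, x.1 = y.1 → x.2 = y.2) :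
    FreeGroup.IsReduced (l ++ m) := by
  unfold FreeGroup.IsReduced at *
  rw [List.isChain_append]; exact ⟨hl, hm, h⟩

lemma getLast?_negL (a : List Bool) : (negL a).getLast? = a.head?.map (fun x => (x, false)) := by
  cases a <;> simp [negL]
lemma head?_negL (a : List Bool) : (negL a).head? = a.getLast?.map (fun x => (x, false)) := by
  simp [negL]
lemma getLast?_posL (a : List Bool) : (posL a).getLast? = a.getLast?.map (fun x => (x, true)) := by
  simp [posL]

/-- the key arithmetic obstruction -/
lemma no_suffix (o : List R) (π : R →+* K) (hL : ((o.length : ℕ) : K) = 0)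
    (ho : ∀ t (h : t < o.length), π o[t] + (t : K) ≠ 0) (v : List Bool) (hv : v ≠ []) :
    ∀ (δ : List Bool) (S : R), π S + δ.length + v.length = 0 →
      ¬ (δ ++ v <:+ vouts o S δ) := by
  intro δ
  induction δ with
  | nil => intro S _; simpa [vouts] using hv
  | cons x δ ih =>
    intro S hS hsuf
    have hS' : π (S + 1) + δ.length + v.length = 0 := by
      rw [← hS]; simp; ring
    have ih' := ih (S + 1) hS'
    cases x
    · simp only [vouts, vout] at hsuf
      simp at hsuf
      exact ih' ((List.suffix_cons _ _).trans hsuf)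
    · simp only [vouts, vout, if_true] at hsuf
      set M := vouts o (S + 1) δ with hM
      have hlenM : ∀ (δ : List Bool) (S : R), (((vouts o S δ).length : ℕ) : K) = 0 := by
        intro δ
        induction δ with
        | nil => intro S; simp [vouts]
        | cons y δ ih => 
          intro S
          cases y <;> simp [vouts, vout, vblock, ih, hL]
      have hlt : M.length < (δ ++ v).length := by
        by_contra hle
        push Not at hle
        apply ih'
        have h1 : δ ++ v <:+ vblock o S ++ M := (List.suffix_cons _ _).trans hsuf
        exact List.suffix_of_suffix_length_le h1 (List.suffix_append _ _) hle
      obtain ⟨pre, hpre⟩ := hsuf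
      have hlen := congrArg List.length hpre
      simp only [List.length_append, List.length_cons, vblock, List.length_map] at hlen hlt
      have ht : pre.length < o.length := by omega
      have hget : (pre ++ (true :: δ ++ v))[pre.length]? = some true := by simp
      rw [hpre, List.getElem?_append_left (by simpa [vblock] using ht)] at hget
      simp only [vblock, List.getElem?_map, List.getElem?_eq_getElem ht, Option.map_some, Option.some.injEq, decide_eq_true_eq] at hget
      apply ho _ ht
      have h1 : π S + π o[pre.length] = 0 := by rw [← map_add, hget, map_zero]
      have h2 : (pre.length : K) + (δ.length + 1 + v.length) = 0 := by
        have := congrArg (Nat.cast : ℕ → K) hlen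
        push_cast at this
        rw [hL, hM, hlenM] at this
        rw [← add_zero (0:K), ← this]
      have h3 : π S + (δ.length + 1) + v.length = 0 := by
        rw [← hS]; simp
      linear_combination h1 + h2 - h3

lemma rf_false_ge (γ : List (Bool × Bool)) (h : ∀ p ∈ γ.head?, p.2 = true) :
    rf true (γ.map Prod.snd) ≤ rf false (γ.map Prod.snd) := by
  cases γ with
  | nil => simp [rf]
  | cons p γ =>
    have : p.2 = true := h p (by simp)
    simp [rf, this]

lemma main_aux (o : List R) (π : R →+* K) (hL : ((o.length : ℕ) : K) = 0)
    (ho : ∀ t (h : t < o.length), π o[t] + (t : K) ≠ 0) :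
    ∀ (γ : List (Bool × Bool)), FreeGroup.IsReduced γ → ∀ (w : List Bool) (S : R),
      π S + w.length = 0 →
      FreeGroup.mk (posL w) * FreeGroup.mk (Hl o S γ) = FreeGroup.mk γ →
      VTo o (fun _ => True) w S := by
  intro γ
  induction γ with
  | nil =>
    intro _ w S _ e
    have : posL w = [] := by
      have := sublist_of_mk_eq (isReduced_posL w) (L₂ := []) (by
        simpa [Hl, ← FreeGroup.one_eq_mk] using e)
      simpa using this
    have : w = [] := by simpa [posL] using this
    subst this
    exact VTo.nil _ trivial
  | cons p γ ih =>
    intro hred w S hS e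
    have hredtail : FreeGroup.IsReduced γ := by
      unfold FreeGroup.IsReduced at *
      exact hred.tail
    cases w with
    | nil => exact VTo.nil _ trivial
    | cons h w =>
    obtain ⟨x, s⟩ := p
    cases s
    · -- negative first letter: impossible
      exfalso
      obtain ⟨δ, γ', hγ, hhead⟩ := exists_neg_start ((x, false) :: γ)
      rw [hγ] at hred e
      have hδ : δ ≠ [] := by
        rintro rfl
        simp only [negL_nil, List.nil_append] at hγ
        have := hhead (x, false) (by simp [← hγ])
        simp at this
      have hred' : FreeGroup.IsReduced γ' := by
        unfold FreeGroup.IsReduced at *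
        rw [List.isChain_append] at hred
        exact hred.2.1
      have hjoin : ∀ x ∈ (negL δ).getLast?, ∀ y ∈ γ'.head?, x.1 = y.1 → x.2 = y.2 := by
        unfold FreeGroup.IsReduced at hred
        rw [List.isChain_append] at hred
        exact hred.2.2
      rw [Hl_negL, ← FreeGroup.mul_mk, ← FreeGroup.mul_mk, mk_negL, mk_negL] at e
      set S' := S - (δ.length : R) with hS'
      set N := vouts o S' δ with hN
      have hno : ¬ (δ ++ (h :: w) <:+ N) := by
        refine no_suffix o π hL ho (h :: w) (by simp) δ S' ?_
        rw [hS', map_sub, map_natCast, sub_add_cancel]; exact hS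
      obtain ⟨a, b, r, hA, hB, hlast⟩ := common_suffix (δ ++ (h :: w)) N
      have ha : a ≠ [] := by
        rintro rfl
        apply hno
        rw [hA, hB]; simp
      have hahead : a.head? = δ.head? := by
        cases a with
        | nil => exact absurd rfl ha
        | cons a0 a =>
          cases δ with
          | nil => exact absurd rfl hδ
          | cons d0 δ => simp only [List.cons_append, List.cons.injEq] at hA; simp [hA.1]
      have hredX : FreeGroup.IsReduced (posL b ++ (negL a ++ γ')) := by
        refine isReduced_append (isReduced_posL b) (isReduced_append (isReduced_negL a) hred' ?_) ?_
        · rw [getLast?_negL, hahead, ← getLast?_negL]; exact hjoin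
        · intro x hx y hy
          rw [getLast?_posL] at hx
          rw [List.head?_append_of_ne_nil _ (by simpa [negL] using ha), head?_negL] at hy
          simp only [Option.mem_def, Option.map_eq_some_iff] at hx hy
          obtain ⟨x, hx, rfl⟩ := hx
          obtain ⟨y, hy, rfl⟩ := hy
          intro hxy
          exact absurd hxy.symm (hlast y hy x hx)
      have hmkA : FreeGroup.mk (posL δ) * FreeGroup.mk (posL (h :: w)) =
          FreeGroup.mk (posL a) * FreeGroup.mk (posL r) := by
        rw [FreeGroup.mul_mk, FreeGroup.mul_mk, ← posL_append, ← posL_append, hA]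
      have hmkN : FreeGroup.mk (posL N) = FreeGroup.mk (posL b) * FreeGroup.mk (posL r) := by
        rw [FreeGroup.mul_mk, ← posL_append, hB]
      have e2 : FreeGroup.mk (posL b ++ (negL a ++ γ')) = FreeGroup.mk (Hl o S' γ') := by
        rw [← FreeGroup.mul_mk, ← FreeGroup.mul_mk, mk_negL]
        have : FreeGroup.mk γ' = FreeGroup.mk (posL δ) * (FreeGroup.mk (posL (h :: w)) *
          ((FreeGroup.mk (posL N))⁻¹ * FreeGroup.mk (Hl o S' γ'))) := by
          rw [e]; group
        rw [this, ← mul_assoc (FreeGroup.mk (posL δ)), hmkA, hmkN]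
        group
      have hsub := sublist_of_mk_eq hredX e2
      have h1 := (rf_mono (hsub.map Prod.snd) true).trans (rf_Hl o γ' S' true)
      rw [List.map_append, snd_posL, rf_replicate_same, List.map_append, snd_negL] at h1
      obtain ⟨k, hk⟩ : ∃ k, a.length = k + 1 := Nat.exists_eq_succ_of_ne_zero (by simpa using ha)
      rw [hk, List.replicate_succ, List.cons_append] at h1
      simp only [rf, Bool.false_eq_true, if_false, rf_replicate_same] at h1
      have := rf_false_ge γ' hhead
      omega
    · by_cases hx : x = h
      · subst hx
        apply VTo.step
        apply ih hredtail
        · have hout : (((vout o x S).length : ℕ) : K) = 0 := by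
            cases x <;> simp [vout, vblock, hL]
          rw [List.length_append, Nat.cast_add, hout]
          rw [List.length_cons] at hS
          push_cast at hS
          rw [map_add, map_one]
          linear_combination hS
        · rw [posL_append, ← FreeGroup.mul_mk]
          simp only [Hl] at e
          rw [← FreeGroup.mul_mk, posL_cons, ← List.singleton_append (l := posL w), ← FreeGroup.mul_mk,
            ← List.singleton_append (l := γ), ← FreeGroup.mul_mk, mul_assoc] at e
          rw [mul_assoc]
          exact mul_left_cancel e
      · exfalso
        have hredX : FreeGroup.IsReduced (negL (h :: w) ++ (x, true) :: γ) := by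
          refine isReduced_append (isReduced_negL _) hred ?_
          rw [getLast?_negL]
          simp only [List.head?_cons, Option.map_some, Option.mem_def, Option.some.injEq, forall_eq']
          intro h'; exact absurd h'.symm hx
        have e2 : FreeGroup.mk (negL (h :: w) ++ (x, true) :: γ) = FreeGroup.mk (Hl o S ((x, true) :: γ)) := by
          rw [← FreeGroup.mul_mk, mk_negL, ← e]; group
        have hsub := sublist_of_mk_eq hredX e2
        have h1 := (rf_mono (hsub.map Prod.snd) true).trans (rf_Hl o _ S true)
        rw [List.map_append, snd_negL, List.length_cons, List.replicate_succ, List.cons_append] at h1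
        simp only [rf, Bool.false_eq_true, if_false, rf_replicate_same, List.map_cons, if_true] at h1
        have := rf_le_succ true false (γ.map Prod.snd)
        simp at h1
        omega

/-- the unpop permutations -/
def unpop (o : List R) (h : Bool) : Equiv.Perm (FreeGroup Bool × R) where
  toFun p := (FreeGroup.of h * p.1 * (FreeGroup.mk (posL (vout o h (p.2 - 1))))⁻¹, p.2 - 1)
  invFun p := ((FreeGroup.of h)⁻¹ * p.1 * FreeGroup.mk (posL (vout o h p.2)), p.2 + 1)
  left_inv p := by
    refine Prod.ext ?_ (sub_add_cancel _ _)
    change (FreeGroup.of h)⁻¹ * (FreeGroup.of h * p.1 * _⁻¹) * _ = p.1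
    group
  right_inv p := by
    refine Prod.ext ?_ (add_sub_cancel_right _ _)
    change FreeGroup.of h * ((FreeGroup.of h)⁻¹ * p.1 * _) * (FreeGroup.mk (posL (vout o h (p.2 + 1 - 1))))⁻¹ = p.1
    rw [add_sub_cancel_right]
    group

/-- membership in the orbit of the accepting state -/
def OrbP (o : List R) (w : FreeGroup Bool) (S : R) : Prop :=
  ∃ γ : FreeGroup Bool, FreeGroup.lift (unpop o) γ (1, 0) = (w, S)

lemma OrbP_iff_unpop (o : List R) (h : Bool) (p : FreeGroup Bool × R) :
    OrbP o (unpop o h p).1 (unpop o h p).2 ↔ OrbP o p.1 p.2 := by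
  constructor
  · rintro ⟨γ, hγ⟩
    refine ⟨(FreeGroup.of h)⁻¹ * γ, ?_⟩
    rw [map_mul, Equiv.Perm.mul_apply, hγ, map_inv, FreeGroup.lift_apply_of]
    simp
  · rintro ⟨γ, hγ⟩
    refine ⟨FreeGroup.of h * γ, ?_⟩
    rw [map_mul, Equiv.Perm.mul_apply, hγ, FreeGroup.lift_apply_of]

lemma OrbP_base (o : List R) : OrbP o 1 0 := ⟨1, by simp⟩

lemma orb_word (o : List R) (γ : List (Bool × Bool)) : ∀ (w : FreeGroup Bool) (S : R),
    FreeGroup.lift (unpop o) (FreeGroup.mk γ) (1, 0) = (w, S) →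
    w * FreeGroup.mk (Hl o S γ) = FreeGroup.mk γ := by
  induction γ with
  | nil =>
    intro w S h
    simp only [← FreeGroup.one_eq_mk, map_one, Equiv.Perm.one_apply, Prod.mk.injEq] at h
    simp [Hl, h.1.symm, ← FreeGroup.one_eq_mk]
  | cons p γ ih =>
    obtain ⟨x, s⟩ := p
    intro w S h
    rw [← List.singleton_append, ← FreeGroup.mul_mk, map_mul, Equiv.Perm.mul_apply] at h
    obtain ⟨⟨w', S'⟩, h'⟩ : ∃ y, y = FreeGroup.lift (unpop o) (FreeGroup.mk γ) (1, 0) := ⟨_, rfl⟩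
    have ih' := ih w' S' h'.symm
    rw [← h'] at h
    cases s
    · have e : FreeGroup.mk [(x, false)] = (FreeGroup.of x)⁻¹ := by simp [FreeGroup.of, FreeGroup.inv_mk, FreeGroup.invRev]
      rw [e, map_inv, FreeGroup.lift_apply_of, Equiv.Perm.inv_def] at h
      change ((FreeGroup.of x)⁻¹ * w' * FreeGroup.mk (posL (vout o x S')), S' + 1) = (w, S) at h
      simp only [Prod.mk.injEq] at h
      obtain ⟨rfl, rfl⟩ := h
      rw [← List.singleton_append (l := γ), ← FreeGroup.mul_mk, e, ← ih']
      simp only [List.singleton_append, Hl, ← FreeGroup.mul_mk, mk_negL, add_sub_cancel_right]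
      group
    · change FreeGroup.lift (unpop o) (FreeGroup.of x) (w', S') = _ at h
      rw [FreeGroup.lift_apply_of] at h
      change (FreeGroup.of x * w' * (FreeGroup.mk (posL (vout o x (S' - 1))))⁻¹, S' - 1) = (w, S) at h
      simp only [Prod.mk.injEq] at h
      obtain ⟨rfl, rfl⟩ := h
      rw [← List.singleton_append (l := γ), ← FreeGroup.mul_mk, ← ih']
      simp only [List.singleton_append, Hl, ← FreeGroup.mul_mk, sub_add_cancel]
      change _ = FreeGroup.of x * _
      group

theorem vto_of_OrbP (o : List R) (π : R →+* K) (hL : ((o.length : ℕ) : K) = 0)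
    (ho : ∀ t (h : t < o.length), π o[t] + (t : K) ≠ 0) (w : List Bool) (S : R)
    (hS : π S + w.length = 0) (h : OrbP o (FreeGroup.mk (posL w)) S) :
    VTo o (fun _ => True) w S := by
  obtain ⟨γ, hγ⟩ := h
  refine main_aux o π hL ho γ.toWord FreeGroup.isReduced_toWord w S hS ?_
  apply orb_word
  rw [FreeGroup.mk_toWord, hγ]

end PartA
end WP


namespace WP

/-! ### Part B : permutations realising HNN-like conjugations -/

section PartB

lemma perm_apply_inv {α : Type*} (f : Equiv.Perm α) (x : α) : f (f⁻¹ x) = x := f.apply_symm_apply x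
lemma perm_inv_apply {α : Type*} (f : Equiv.Perm α) (x : α) : f⁻¹ (f x) = x := f.symm_apply_apply x

lemma free_equiv {Y : Type} [Countable Y] (A B : Equiv.Perm Y) (φ : Y → FreeGroup Bool)
    (hA : ∀ y, φ (A y) = FreeGroup.of true * φ y) (hB : ∀ y, φ (B y) = FreeGroup.of false * φ y)
    (ν : Y → ℕ) (hν : Function.Surjective ν) (νA : ∀ y, ν (A y) = ν y) (νB : ∀ y, ν (B y) = ν y) :
    ∃ e : Y ≃ FreeGroup Bool × ℕ, (∀ y, e (A y) = (FreeGroup.of true * (e y).1, (e y).2)) ∧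
      (∀ y, e (B y) = (FreeGroup.of false * (e y).1, (e y).2)) := by
  let ρ : FreeGroup Bool →* Equiv.Perm Y := FreeGroup.lift (fun b => if b then A else B)
  have ρt : ρ (FreeGroup.of true) = A := by simp [ρ]
  have ρf : ρ (FreeGroup.of false) = B := by simp [ρ]
  have key : ∀ h : FreeGroup Bool, ∀ y, φ (ρ h y) = h * φ y ∧ ν (ρ h y) = ν y := by
    intro h
    induction h using FreeGroup.induction_on with
    | C1 => simp
    | of b => cases b <;> simp [ρt, ρf, hA, hB, νA, νB]
    | inv_of b ih =>
      intro y
      have := ih ((ρ (FreeGroup.of b))⁻¹ y)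
      rw [perm_apply_inv] at this
      rw [map_inv]
      refine ⟨?_, this.2.symm⟩
      rw [this.1]; group
    | mul x y hx hy =>
      intro v
      rw [map_mul, Equiv.Perm.mul_apply, (hx _).1, (hx _).2, (hy _).1, (hy _).2, mul_assoc]
      exact ⟨rfl, rfl⟩
  let X := {y : Y // φ y = 1}
  have hinf : Infinite X := by
    refine Infinite.of_surjective (fun x : X => ν x.1) ?_
    intro n
    obtain ⟨y, rfl⟩ := hν n
    exact ⟨⟨ρ (φ y)⁻¹ y, by rw [(key _ _).1]; group⟩, (key _ _).2⟩
  obtain ⟨hden⟩ := nonempty_denumerable X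
  let ex : X ≃ ℕ := Denumerable.eqv X
  have hX : ∀ y, φ (ρ (φ y)⁻¹ y) = 1 := fun y => by rw [(key _ _).1]; group
  let e : Y ≃ FreeGroup Bool × ℕ :=
    { toFun := fun y => (φ y, ex ⟨ρ (φ y)⁻¹ y, hX y⟩)
      invFun := fun p => ρ p.1 (ex.symm p.2).1
      left_inv := by
        intro y
        simp only [Equiv.symm_apply_apply, map_inv, perm_apply_inv]
      right_inv := by
        rintro ⟨h, n⟩
        have h1 : φ (ρ h (ex.symm n).1) = h := by rw [(key _ _).1, (ex.symm n).2, mul_one]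
        refine Prod.ext h1 ?_
        change ex _ = n
        rw [← Equiv.eq_symm_apply]
        apply Subtype.ext
        simp only [h1, map_inv, perm_inv_apply] }
  have he : ∀ b y, e (ρ (FreeGroup.of b) y) = (FreeGroup.of b * (e y).1, (e y).2) := by
    intro b y
    have h1 : φ (ρ (FreeGroup.of b) y) = FreeGroup.of b * φ y := (key _ _).1
    refine Prod.ext h1 ?_
    change ex _ = ex _
    congr 1
    apply Subtype.ext
    simp only [h1]
    rw [mul_inv_rev, map_mul, Equiv.Perm.mul_apply, map_inv ρ (FreeGroup.of b), perm_inv_apply]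
  exact ⟨e, fun y => by rw [← he, ρt], fun y => by rw [← he, ρf]⟩

/-- odometer -/
def odo (g : ℕ) : Equiv.Perm (FreeGroup Bool × ZMod g) where
  toFun p := (if p.2 + 1 = 0 then FreeGroup.of true * p.1 else p.1, p.2 + 1)
  invFun p := (if p.2 = 0 then (FreeGroup.of true)⁻¹ * p.1 else p.1, p.2 - 1)
  left_inv p := by
    refine Prod.ext ?_ (add_sub_cancel_right _ _)
    simp only
    split_ifs <;> simp
  right_inv p := by
    refine Prod.ext ?_ (sub_add_cancel _ _)
    simp only [sub_add_cancel]
    split_ifs <;> simp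

lemma odo_pow (g : ℕ) [NeZero g] (p : FreeGroup Bool × ZMod g) :
    (odo g ^ g) p = (FreeGroup.of true * p.1, p.2) := by
  have h1 : ∀ k, k < g → ∀ v, (odo g ^ k) (v, 0) = (v, (k : ZMod g)) := by
    intro k
    induction k with
    | zero => intro _ v; simp
    | succ k ih =>
      intro hk v
      rw [pow_succ', Equiv.Perm.mul_apply, ih (by omega)]
      have : ((k : ZMod g) + 1) ≠ 0 := by
        intro h
        have h2 : ((k + 1 : ℕ) : ZMod g) = 0 := by push_cast; exact h
        rw [ZMod.natCast_eq_zero_iff] at h2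
        exact absurd (Nat.le_of_dvd (by omega) h2) (by omega)
      simp [odo, this]
  have h2 : ∀ v, (odo g ^ g) (v, 0) = (FreeGroup.of true * v, (0 : ZMod g)) := by
    intro v
    obtain ⟨k, hk⟩ : ∃ k, g = k + 1 := Nat.exists_eq_succ_of_ne_zero (NeZero.ne g)
    have e1 : (odo g ^ g) = odo g * odo g ^ k := by
      rw [← pow_succ']; congr 1
    rw [e1, Equiv.Perm.mul_apply, h1 k (by omega)]
    have : ((k : ZMod g) + 1) = 0 := by
      have : ((k + 1 : ℕ) : ZMod g) = 0 := by rw [← hk]; simp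
      exact_mod_cast this
    simp [odo, this]
  obtain ⟨v, j⟩ := p
  have h3 := h1 j.val (ZMod.val_lt j) v
  rw [ZMod.natCast_zmod_val] at h3
  rw [← h3, ← Equiv.Perm.mul_apply, ← pow_add, add_comm, pow_add, Equiv.Perm.mul_apply, h2,
    h1 j.val (ZMod.val_lt j), h1 j.val (ZMod.val_lt j), ZMod.natCast_zmod_val]

lemma exists_root_map (g : ℕ) [NeZero g] : ∃ ψ : FreeGroup Bool → FreeGroup Bool,
    (∀ v, ψ (FreeGroup.of true ^ g * v) = FreeGroup.of true * ψ v) ∧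
    (∀ v, ψ (FreeGroup.of false * v) = FreeGroup.of false * ψ v) := by
  let ct : Equiv.Perm (FreeGroup Bool × ZMod g) :=
    Equiv.prodCongr (Equiv.mulLeft (FreeGroup.of false)) (Equiv.refl _)
  let ρ : FreeGroup Bool →* Equiv.Perm (FreeGroup Bool × ZMod g) :=
    FreeGroup.lift (fun b => if b then odo g else ct)
  have ρt : ρ (FreeGroup.of true) = odo g := by simp [ρ]
  have ρf : ρ (FreeGroup.of false) = ct := by simp [ρ]
  refine ⟨fun v => (ρ v (1, 0)).1, fun v => ?_, fun v => ?_⟩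
  · simp only; rw [map_mul, map_pow, ρt, Equiv.Perm.mul_apply, odo_pow]
  · simp only; rw [map_mul, ρf, Equiv.Perm.mul_apply]; rfl

lemma exists_conj {Y : Type} [Countable Y] (A B : Equiv.Perm Y) (φ : Y → FreeGroup Bool)
    (hA : ∀ y, φ (A y) = FreeGroup.of true * φ y) (hB : ∀ y, φ (B y) = FreeGroup.of false * φ y)
    (ν : Y → ℕ) (hν : Function.Surjective ν) (νA : ∀ y, ν (A y) = ν y) (νB : ∀ y, ν (B y) = ν y)
    (g : ℕ) [NeZero g] : ∃ w : Equiv.Perm Y, w * A = A ^ g * w ∧ Commute w B := by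
  obtain ⟨e, eA, eB⟩ := free_equiv A B φ hA hB ν hν νA νB
  obtain ⟨ψ, ψ1, ψ2⟩ := exists_root_map g
  have hpow : ∀ k y, φ ((A ^ k) y) = FreeGroup.of true ^ k * φ y ∧ ν ((A ^ k) y) = ν y := by
    intro k
    induction k with
    | zero => simp
    | succ k ih => intro y; rw [pow_succ', Equiv.Perm.mul_apply, hA, νA, (ih y).1, (ih y).2, pow_succ', mul_assoc]; simp
  obtain ⟨e', eA', eB'⟩ := free_equiv (A ^ g) B (fun y => ψ (φ y))
    (fun y => by rw [(hpow g y).1, ψ1]) (fun y => by rw [hB, ψ2]) ν hν (fun y => (hpow g y).2) νB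
  refine ⟨e.trans e'.symm, ?_, ?_⟩
  · ext y
    apply e'.injective
    simp [Equiv.Perm.mul_apply, eA, eA']
  · change _ = _
    ext y
    apply e'.injective
    simp [Equiv.Perm.mul_apply, eB, eB']

end PartB
end WP


namespace WP

/-! ### Part C : the relators and the permutation model -/

section PartC

section defs
variable {G : Type*} [Group G]

def cm (a b : G) : G := a * b * a⁻¹ * b⁻¹

lemma cm_eq_one {a b : G} : cm a b = 1 ↔ Commute a b := by
  unfold cm
  rw [mul_inv_eq_one, mul_inv_eq_iff_eq_mul]; rfl

def xk (p x : G) (k : ℕ) : G := p ^ k * x * (p ^ k)⁻¹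

def uW (o : List ℕ) (a b : G) : G := (o.map (fun n => a ^ n * b * (a ^ n)⁻¹)).prod * a

/-- the twelve relators, evaluated in a group -/
def relG (q g : ℕ) (o : List ℕ) (z p x ω t : G) : Fin 12 → G :=
  ![p ^ 4, cm (x) (xk p x 1), ω * x * ω⁻¹ * (x ^ g)⁻¹, cm (ω) (xk p x 2 * xk p x 1),
    cm (z) (x * xk p x 1), cm (z) (xk p x 2 * xk p x 3), cm (t) (ω), cm (t) (x ^ (q ^ 2)),
    cm (t) (x * (xk p x 2 * xk p x 1) * x⁻¹), cm (t) (x ^ q * (xk p x 2 * xk p x 1) * (x ^ q)⁻¹),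
    cm (t) (xk p x 2 * uW o (xk p x 1) (xk p x 3)), t * z * t⁻¹ * (z ^ 2)⁻¹]

def cfgG (p x : G) (w : List Bool) : G :=
  (w.map (fun b => if b then xk p x 2 else x * xk p x 2 * x⁻¹)).prod

def testG (z t W : G) : G := t * (W * z * W⁻¹) * t⁻¹ * (W * z ^ 2 * W⁻¹)⁻¹

variable {H : Type*} [Group H] (f : G →* H)

lemma map_xk (p x : G) (k : ℕ) : f (xk p x k) = xk (f p) (f x) k := by simp [xk]
lemma map_uW (o : List ℕ) (a b : G) : f (uW o a b) = uW o (f a) (f b) := by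
  simp [uW, map_list_prod, Function.comp_def]
lemma map_relG (q g : ℕ) (o : List ℕ) (z p x ω t : G) (i : Fin 12) :
    f (relG q g o z p x ω t i) = relG q g o (f z) (f p) (f x) (f ω) (f t) i := by
  fin_cases i <;> simp [relG, map_xk, map_uW, cm]
lemma map_cfgG (p x : G) (w : List Bool) : f (cfgG p x w) = cfgG (f p) (f x) w := by
  simp only [cfgG, map_list_prod, List.map_map]
  congr 1
  apply List.map_congr_left
  intro b _
  cases b <;> simp [map_xk]
lemma map_testG (z t W : G) : f (testG z t W) = testG (f z) (f t) (f W) := by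
  simp [testG]
end defs

/-- product of permutations as a homomorphism -/
def pc (α β : Type*) : Equiv.Perm α × Equiv.Perm β →* Equiv.Perm (α × β) where
  toFun p := Equiv.prodCongr p.1 p.2
  map_one' := by ext <;> simp
  map_mul' a b := by ext <;> simp

@[simp] lemma pc_apply {α β : Type*} (p : Equiv.Perm α × Equiv.Perm β) (x : α × β) : pc α β p x = (p.1 x.1, p.2 x.2) := rfl

section bar
variable (β : ℕ) (u : (ZMod β)ˣ)

abbrev YB : Type := FreeGroup (ZMod β) × ZMod β × ℤ

def au (k : ℤ) : ZMod β := ((u ^ (-k) : (ZMod β)ˣ) : ZMod β)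

lemma map_shift (a b : ZMod β) (h : a + b = 0) (w : FreeGroup (ZMod β)) :
    FreeGroup.map (· + a) (FreeGroup.map (· + b) w) = w := by
  rw [FreeGroup.map.comp]
  have : (fun x : ZMod β => x + a) ∘ (fun x => x + b) = id := by
    funext x; simp [add_assoc, add_comm b a, h]
  rw [this, FreeGroup.map.id]

def yb0 : Equiv.Perm (YB β) where
  toFun p := (FreeGroup.map (· + au β u p.2.2) p.1, p.2.1 + au β u p.2.2, p.2.2)
  invFun p := (FreeGroup.map (· + - au β u p.2.2) p.1, p.2.1 + - au β u p.2.2, p.2.2)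
  left_inv p := by
    refine Prod.ext ?_ (Prod.ext ?_ rfl)
    · exact map_shift β _ _ (by simp) _
    · simp
  right_inv p := by
    refine Prod.ext ?_ (Prod.ext ?_ rfl)
    · exact map_shift β _ _ (by simp) _
    · simp

def yb2 : Equiv.Perm (YB β) := Equiv.prodCongr (Equiv.mulLeft (FreeGroup.of 0)) (Equiv.refl _)

def yb1 : Equiv.Perm (YB β) := Equiv.prodCongr (Equiv.refl _)
  (Equiv.prodCongr (Equiv.addRight (-1)) (Equiv.refl _))

def yb3 : Equiv.Perm (YB β) where
  toFun p := (p.1 * (FreeGroup.of p.2.1)⁻¹, p.2)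
  invFun p := (p.1 * FreeGroup.of p.2.1, p.2)
  left_inv p := by simp
  right_inv p := by simp

def wb0 : Equiv.Perm (YB β) := Equiv.prodCongr (Equiv.refl _)
  (Equiv.prodCongr (Equiv.refl _) (Equiv.addRight 1))

lemma yb0_pow (n : ℕ) (p : YB β) : (yb0 β u ^ n) p =
    (FreeGroup.map (· + n * au β u p.2.2) p.1, p.2.1 + n * au β u p.2.2, p.2.2) := by
  induction n with
  | zero => simp
  | succ n ih =>
    rw [pow_succ', Equiv.Perm.mul_apply, ih]
    refine Prod.ext ?_ (Prod.ext ?_ rfl)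
    · simp only [yb0, Equiv.coe_fn_mk]
      rw [FreeGroup.map.comp]
      congr 2
      funext x
      simp; ring
    · simp only [yb0, Equiv.coe_fn_mk]
      push_cast; ring

lemma yb1_pow (n : ℕ) (p : YB β) : (yb1 β ^ n) p = (p.1, p.2.1 - n, p.2.2) := by
  induction n with
  | zero => simp
  | succ n ih =>
    rw [pow_succ', Equiv.Perm.mul_apply, ih]
    refine Prod.ext rfl (Prod.ext ?_ rfl)
    simp [yb1]; ring

lemma yb1_pow_inv (n : ℕ) (p : YB β) : (yb1 β ^ n)⁻¹ p = (p.1, p.2.1 + n, p.2.2) := by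
  rw [Equiv.Perm.inv_eq_iff_eq, yb1_pow]; simp

lemma yb01 : Commute (yb0 β u) (yb1 β) := by
  ext p <;> simp [yb0, yb1]; ring
lemma yb12 : Commute (yb1 β) (yb2 β) := by
  ext p <;> simp [yb1, yb2]
lemma yb23 : Commute (yb2 β) (yb3 β) := by
  ext p <;> simp [yb3, yb2, mul_assoc]
lemma yb30 : Commute (yb3 β) (yb0 β u) := by
  ext p <;> simp [yb3, yb0]

lemma wb_conj (g : ℕ) (hg : (g : ZMod β) = u) : wb0 β * yb0 β u = yb0 β u ^ g * wb0 β := by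
  ext p : 1
  rw [Equiv.Perm.mul_apply, Equiv.Perm.mul_apply, yb0_pow]
  have : (g : ZMod β) * au β u (p.2.2 + 1) = au β u p.2.2 := by
    rw [hg, au, au, ← Units.val_mul]
    congr 1
    rw [neg_add, zpow_add, mul_comm (u ^ _)]
    simp
  simp [wb0, yb0, this]

lemma wb_comm : Commute (wb0 β) (yb2 β * yb1 β) := by
  ext p <;> simp [wb0, yb2, yb1]

lemma uW_bar (o : List (ZMod β)) (ho : NeZero β) (p : YB β) :
    (yb2 β * uW (o.map ZMod.val) (yb1 β) (yb3 β)) p =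
      (FreeGroup.of 0 * p.1 * ((o.map (fun a => FreeGroup.of (p.2.1 - 1 + a))).prod)⁻¹,
        p.2.1 - 1, p.2.2) := by
  have h1 : ∀ (l : List (ZMod β)) (p : YB β),
      ((((l.map ZMod.val).map (fun n => yb1 β ^ n * yb3 β * (yb1 β ^ n)⁻¹)).prod)) p =
      (p.1 * ((l.map (fun a => FreeGroup.of (p.2.1 + a))).prod)⁻¹, p.2) := by
    intro l
    induction l with
    | nil => intro p; simp
    | cons a l ih =>
      intro p
      rw [List.map_cons, List.map_cons, List.prod_cons, Equiv.Perm.mul_apply, ih,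
        Equiv.Perm.mul_apply, Equiv.Perm.mul_apply, yb1_pow_inv, yb1_pow]
      simp [yb3, mul_assoc]
  rw [uW, Equiv.Perm.mul_apply, Equiv.Perm.mul_apply, h1]
  simp [yb2, yb1, mul_assoc, sub_eq_add_neg]
  rfl

/-- accepting predicate on the bar space -/
def PB (o : List (ZMod β)) (p : YB β) : Prop :=
  OrbP o (FreeGroup.map (fun a => decide (a = 0)) p.1) p.2.1

lemma conj_bar (n : ℕ) (p : YB β) :
    (yb0 β u ^ n * (yb2 β * yb1 β) * (yb0 β u ^ n)⁻¹) p =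
      (FreeGroup.of (n * au β u p.2.2) * p.1, p.2.1 - 1, p.2.2) := by
  obtain ⟨p, rfl⟩ := (yb0 β u ^ n).surjective p
  rw [Equiv.Perm.mul_apply, perm_inv_apply, Equiv.Perm.mul_apply, yb0_pow, yb0_pow]
  simp [yb2, yb1]
  ring

lemma PB_skip (o : List (ZMod β)) (p : YB β) (a : ZMod β) (ha : a ≠ 0) :
    PB β o (FreeGroup.of a * p.1, p.2.1 - 1, p.2.2) ↔ PB β o p := by
  unfold PB
  rw [← OrbP_iff_unpop o false (FreeGroup.map (fun a => decide (a = 0)) p.1, p.2.1)]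
  simp [unpop, vout, ha, ← FreeGroup.one_eq_mk]

lemma PB_exec (o : List (ZMod β)) (p : YB β) :
    PB β o (FreeGroup.of 0 * p.1 * ((o.map (fun a => FreeGroup.of (p.2.1 - 1 + a))).prod)⁻¹,
        p.2.1 - 1, p.2.2) ↔ PB β o p := by
  unfold PB
  rw [← OrbP_iff_unpop o true (FreeGroup.map (fun a => decide (a = 0)) p.1, p.2.1)]
  have : ∀ l : List Bool, (l.map FreeGroup.of).prod = FreeGroup.mk (posL l) := by
    intro l
    induction l with
    | nil => rfl
    | cons x l ih => rw [List.map_cons, List.prod_cons, ih, posL_cons]; rfl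
  simp only [unpop, Equiv.coe_fn_mk, vout, if_true, ← this, map_mul, map_inv, map_list_prod,
    List.map_map, vblock, FreeGroup.map.of, Function.comp_def, decide_true]

end bar
end PartC
end WP


namespace WP

/-! ### Part D : the full permutation model -/

section PartD

section fib
variable {Y : Type}

/-- fibrewise permutations -/
def Fib (Y : Type) : (Fin 4 → Equiv.Perm Y) →* Equiv.Perm (Fin 4 × Y × ZMod 3) where
  toFun f :=
    { toFun := fun a => (a.1, f a.1 a.2.1, a.2.2)
      invFun := fun a => (a.1, (f a.1).symm a.2.1, a.2.2)
      left_inv := fun a => by simp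
      right_inv := fun a => by simp }
  map_one' := by ext a : 1; simp
  map_mul' f g := by ext a : 1; simp

@[simp] lemma Fib_apply (f : Fin 4 → Equiv.Perm Y) (a) : Fib Y f a = (a.1, f a.1 a.2.1, a.2.2) := rfl

def rotP (Y : Type) : Equiv.Perm (Fin 4 × Y × ZMod 3) :=
  Equiv.prodCongr (Equiv.addRight 1) (Equiv.refl _)

@[simp] lemma rotP_apply (a) : rotP Y a = (a.1 + 1, a.2) := rfl

lemma rotP_conj (f : Fin 4 → Equiv.Perm Y) :
    rotP Y * Fib Y f * (rotP Y)⁻¹ = Fib Y (fun j => f (j - 1)) := by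
  rw [mul_inv_eq_iff_eq_mul]
  ext a : 1
  simp

lemma rotP_xk (f : Fin 4 → Equiv.Perm Y) (k : ℕ) :
    xk (rotP Y) (Fib Y f) k = Fib Y (fun j => f (j - k • (1 : Fin 4))) := by
  induction k with
  | zero => simp [xk]
  | succ k ih =>
    have : xk (rotP Y) (Fib Y f) (k + 1) = rotP Y * xk (rotP Y) (Fib Y f) k * (rotP Y)⁻¹ := by
      simp only [xk, pow_succ']; group
    rw [this, ih, rotP_conj]
    congr 1
    funext j
    congr 1
    rw [succ_nsmul]
    abel

open Classical in
noncomputable def cnd (D : Y → Prop) (σ : Equiv.Perm (ZMod 3)) : Equiv.Perm (Fin 4 × Y × ZMod 3) where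
  toFun a := (a.1, a.2.1, if a.1 = 0 ∧ D a.2.1 then σ a.2.2 else a.2.2)
  invFun a := (a.1, a.2.1, if a.1 = 0 ∧ D a.2.1 then σ.symm a.2.2 else a.2.2)
  left_inv a := by
    refine Prod.ext rfl (Prod.ext rfl ?_)
    simp only; split_ifs <;> simp
  right_inv a := by
    refine Prod.ext rfl (Prod.ext rfl ?_)
    simp only; split_ifs <;> simp

lemma cnd_pos (D : Y → Prop) (σ : Equiv.Perm (ZMod 3)) (y : Y) (h : D y) (i) :
    cnd D σ (0, y, i) = (0, y, σ i) := by simp [cnd, h]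
lemma cnd_neg (D : Y → Prop) (σ : Equiv.Perm (ZMod 3)) (j : Fin 4) (y : Y) (h : ¬ (j = 0 ∧ D y)) (i) :
    cnd D σ (j, y, i) = (j, y, i) := by simp only [cnd, Equiv.coe_fn_mk, if_neg h]

lemma cnd_commute (D : Y → Prop) (σ : Equiv.Perm (ZMod 3)) (f : Fin 4 → Equiv.Perm Y)
    (h : ∀ y, D (f 0 y) ↔ D y) : Commute (cnd D σ) (Fib Y f) := by
  change _ = _
  ext a : 1
  obtain ⟨j, y, i⟩ := a
  simp only [Equiv.Perm.mul_apply, Fib_apply]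
  by_cases hj : j = 0
  · subst hj
    by_cases hD : D y
    · rw [cnd_pos _ _ _ hD, cnd_pos _ _ _ ((h y).2 hD)]
    · rw [cnd_neg _ _ _ _ (fun h' => hD ((h y).1 h'.2)), cnd_neg _ _ _ _ (fun h' => hD h'.2)]
  · rw [cnd_neg _ _ _ _ (by simp [hj]), cnd_neg _ _ _ _ (by simp [hj])]

end fib

abbrev ZN : Type := (FreeGroup Bool × FreeGroup Bool) × ℕ

def zl (b : Bool) : Equiv.Perm ZN :=
  Equiv.prodCongr (Equiv.prodCongr (Equiv.mulLeft (FreeGroup.of b)) (Equiv.refl _)) (Equiv.refl _)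
def zr (b : Bool) : Equiv.Perm ZN :=
  Equiv.prodCongr (Equiv.prodCongr (Equiv.refl _) (Equiv.mulLeft (FreeGroup.of b))) (Equiv.refl _)

lemma zl_zr (a b : Bool) : Commute (zl a) (zr b) := by
  ext p <;> simp [zl, zr]

variable (β : ℕ) (u : (ZMod β)ˣ)

abbrev YF : Type := YB β × ZN

def yp : Fin 4 → Equiv.Perm (YB β) × Equiv.Perm ZN :=
  ![(yb0 β u, zl true), (yb1 β, zr true), (yb2 β, zl false), (yb3 β, zr false)]

def yF (k : Fin 4) : Equiv.Perm (YF β) := pc _ _ (yp β u k)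

lemma yp_comm (k : Fin 4) : Commute (yp β u k) (yp β u (k + 1)) := by
  fin_cases k
  · exact Commute.prod (yb01 β u) (zl_zr _ _)
  · exact Commute.prod (yb12 β) (zl_zr _ _).symm
  · exact Commute.prod (yb23 β) (zl_zr _ _)
  · exact Commute.prod (yb30 β u) (zl_zr _ _).symm

lemma yF_comm (k : Fin 4) : Commute (yF β u k) (yF β u (k + 1)) :=
  (yp_comm β u k).map _

lemma map_not_of (b : Bool) (v : FreeGroup Bool) : FreeGroup.map (fun b => !b) (FreeGroup.of b * v) =
    FreeGroup.of (!b) * FreeGroup.map (fun b => !b) v := by simp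

lemma exists_wF [NeZero β] (g : ℕ) [NeZero g] (hg : (g : ZMod β) = u) :
    ∃ (w : Fin 4 → Equiv.Perm (YF β)) (w' : Equiv.Perm ZN),
      (∀ k, w k * yF β u k = yF β u k ^ g * w k) ∧
      (∀ k, Commute (w k) (yF β u (k + 2) * yF β u (k + 1))) ∧
      w 0 = pc _ _ (wb0 β, w') := by
  have hs : Function.Surjective (fun y : YF β => y.2.2) := fun n => ⟨(1, (1, n)), rfl⟩
  obtain ⟨w', h1', h2'⟩ := exists_conj (Y := ZN) (zl true) (zl false * zr true) (fun y => y.1.1)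
    (fun y => rfl) (fun y => rfl) (fun y => y.2) (fun n => ⟨(1, n), rfl⟩) (fun y => rfl) (fun y => rfl) g
  obtain ⟨w1, h1, h1c⟩ := exists_conj (Y := YF β) (yF β u 1) (yF β u 3 * yF β u 2) (fun y => y.2.1.2)
    (fun y => rfl) (fun y => rfl) (fun y => y.2.2) hs (fun y => rfl) (fun y => rfl) g
  obtain ⟨w2, h2, h2c⟩ := exists_conj (Y := YF β) (yF β u 2) (yF β u 0 * yF β u 3)
    (fun y => FreeGroup.map (fun b => !b) y.2.1.1)
    (fun y => map_not_of false _) (fun y => map_not_of true _) (fun y => y.2.2) hs (fun y => rfl) (fun y => rfl) g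
  obtain ⟨w3, h3, h3c⟩ := exists_conj (Y := YF β) (yF β u 3) (yF β u 1 * yF β u 0)
    (fun y => FreeGroup.map (fun b => !b) y.2.1.2)
    (fun y => map_not_of false _) (fun y => map_not_of true _) (fun y => y.2.2) hs (fun y => rfl) (fun y => rfl) g
  refine ⟨![pc _ _ (wb0 β, w'), w1, w2, w3], w', ?_, ?_, rfl⟩
  · intro k
    fin_cases k
    · change pc _ _ (wb0 β, w') * pc _ _ (yb0 β u, zl true) = pc _ _ (yb0 β u, zl true) ^ g * pc _ _ (wb0 β, w')
      rw [← map_mul, ← map_pow, ← map_mul]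
      congr 1
      exact Prod.ext (wb_conj β u g hg) h1'
    · exact h1
    · exact h2
    · exact h3
  · intro k
    fin_cases k
    · change Commute (pc _ _ (wb0 β, w')) (pc _ _ (yb2 β, zl false) * pc _ _ (yb1 β, zr true))
      rw [← map_mul]
      exact Commute.map (Commute.prod (wb_comm β) h2') _
    · exact h1c
    · exact h2c
    · exact h3c


section final
variable (q : ℕ)

lemma xk_fib {Y : Type} (f : Fin 4 → Equiv.Perm Y) (k : ℕ) (m : Fin 4) (h : k • (1 : Fin 4) = m) :
    xk (rotP Y) (Fib Y (fun j => f (-j))) k = Fib Y (fun j => f (m - j)) := by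
  rw [rotP_xk]
  congr 1
  funext j
  rw [h]
  congr 1
  abel

lemma cfg_bar (w : List Bool) :
    (w.map (fun b => if b then yb2 β else yb0 β u * yb2 β * (yb0 β u)⁻¹)).prod (1, 0, 0) =
      ((w.map (fun b => FreeGroup.of (if b then (0 : ZMod β) else 1))).prod, 0, 0) := by
  induction w with
  | nil => rfl
  | cons b w ih =>
    rw [List.map_cons, List.prod_cons, Equiv.Perm.mul_apply, ih, List.map_cons, List.prod_cons]
    cases b
    · simp only [Bool.false_eq_true, if_false, Equiv.Perm.mul_apply]
      have : (yb0 β u)⁻¹ = (yb0 β u).symm := rfl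
      rw [this]
      simp only [yb0, yb2, Equiv.coe_fn_symm_mk, Equiv.coe_fn_mk, Equiv.prodCongr_apply, Prod.map,
        Equiv.coe_mulLeft, Equiv.refl_apply, map_mul, FreeGroup.map.of]
      rw [map_shift β _ _ (by simp)]
      simp [au]
    · simp [yb2]

/-- the finite group of relations holds in the permutation model, and the model
detects acceptance -/
theorem model [NeZero (q ^ 2)] (u : (ZMod (q ^ 2))ˣ) (g : ℕ) [NeZero g]
    (hg : (g : ZMod (q ^ 2)) = u) (hq : (q : ZMod (q ^ 2)) ≠ 0) (o : List (ZMod (q ^ 2))) :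
    ∃ z p x ω t : Equiv.Perm (Fin 4 × YF (q ^ 2) × ZMod 3),
      (∀ i, relG q g (o.map ZMod.val) z p x ω t i = 1) ∧
      ∀ w : List Bool, testG z t (cfgG p x w) = 1 → OrbP o (FreeGroup.mk (posL w)) 0 := by
  obtain ⟨w, w', hw1, hw2, hw3⟩ := exists_wF (q ^ 2) u g hg
  have hnt : (1 : ZMod (q ^ 2)) ≠ 0 := by
    intro h
    apply hq
    rw [← mul_one (q : ZMod (q ^ 2)), h, mul_zero]
  have hau : ∀ (n : ZMod (q ^ 2)) k, n ≠ 0 → n * au (q ^ 2) u k ≠ 0 := by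
    intro n k hn h
    apply hn
    simpa [au] using h
  let p := rotP (YF (q ^ 2))
  let x := Fib _ (fun j => yF (q ^ 2) u (-j))
  let ω := Fib _ (fun j => w (-j))
  let D0 : YF (q ^ 2) → Prop := fun y => y.1 = (1, 0, 0)
  let DP : YF (q ^ 2) → Prop := fun y => PB (q ^ 2) o y.1
  let z := cnd D0 (Equiv.addRight 1)
  let t := cnd DP (Equiv.neg (ZMod 3))
  have hx1 : xk p x 1 = Fib _ (fun j => yF (q ^ 2) u (1 - j)) := xk_fib _ _ _ (by decide)
  have hx2 : xk p x 2 = Fib _ (fun j => yF (q ^ 2) u (2 - j)) := xk_fib _ _ _ (by decide)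
  have hx3 : xk p x 3 = Fib _ (fun j => yF (q ^ 2) u (3 - j)) := xk_fib _ _ _ (by decide)
  have ht : ∀ (f : Fin 4 → Equiv.Perm (YF (q ^ 2))) (a : Equiv.Perm (YB (q ^ 2))) b,
      f 0 = pc _ _ (a, b) → (∀ y, PB (q ^ 2) o (a y) ↔ PB (q ^ 2) o y) → Commute t (Fib _ f) := by
    intro f a b hf h
    apply cnd_commute
    intro y
    rw [hf]
    exact h y.1
  have hz : ∀ (f : Fin 4 → Equiv.Perm (YF (q ^ 2))) (a : Equiv.Perm (YB (q ^ 2))) b,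
      f 0 = pc _ _ (a, b) → a (1, 0, 0) = (1, 0, 0) → Commute z (Fib _ f) := by
    intro f a b hf h
    apply cnd_commute
    intro y
    rw [hf]
    change a y.1 = (1, 0, 0) ↔ y.1 = (1, 0, 0)
    constructor
    · intro h'; apply a.injective; rw [h', h]
    · intro h'; rw [h', h]
  have hskip : ∀ n : ℕ, (n : ZMod (q ^ 2)) ≠ 0 →
      Commute t (x ^ n * (xk p x 2 * xk p x 1) * (x ^ n)⁻¹) := by
    intro n hn
    rw [hx1, hx2, ← map_pow, ← map_mul, ← map_inv, ← map_mul, ← map_mul]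
    refine ht _ (yb0 _ u ^ n * (yb2 _ * yb1 _) * (yb0 _ u ^ n)⁻¹) (zl true ^ n * (zl false * zr true) * (zl true ^ n)⁻¹) ?_ ?_
    · change pc _ _ (yp _ u 0) ^ n * (pc _ _ (yp _ u 2) * pc _ _ (yp _ u 1)) * (pc _ _ (yp _ u 0) ^ n)⁻¹ = _
      rw [← map_pow, ← map_mul, ← map_inv, ← map_mul, ← map_mul]
      rfl
    · intro y
      rw [conj_bar]
      exact PB_skip _ _ _ _ (hau _ _ hn)
  have hD0P : ∀ y, D0 y → DP y := by
    intro y hy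
    have hy' : y.1 = (1, 0, 0) := hy
    change PB _ _ y.1
    rw [hy']
    unfold PB
    rw [map_one]
    exact OrbP_base o
  refine ⟨z, p, x, ω, t, ?_, ?_⟩
  · intro i
    fin_cases i
    · change p ^ 4 = 1
      ext a : 1
      obtain ⟨j, a⟩ := a
      change (j + 1 + 1 + 1 + 1, a) = (j, a)
      congr 1
      revert j; decide
    · refine cm_eq_one.2 ?_
      rw [hx1]
      refine Commute.map ?_ _
      refine Pi.commute_iff.2 fun j => ?_
      have := yF_comm (q ^ 2) u (-j)
      rwa [show -j + 1 = 1 - j by abel] at this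
    · refine mul_inv_eq_one.2 (mul_inv_eq_iff_eq_mul.2 ?_)
      change Fib _ _ * Fib _ _ = Fib _ _ ^ g * Fib _ _
      rw [← map_pow, ← map_mul, ← map_mul]
      congr 1
      funext j
      exact hw1 (-j)
    · refine cm_eq_one.2 ?_
      rw [hx1, hx2, ← map_mul]
      refine Commute.map ?_ _
      refine Pi.commute_iff.2 fun j => ?_
      have := hw2 (-j)
      rw [show -j + 1 = 1 - j by abel, show -j + 2 = 2 - j by abel] at this
      exact this
    · refine cm_eq_one.2 ?_
      rw [hx1, ← map_mul]
      refine hz _ (yb0 _ u * yb1 _) (zl true * zr true) ?_ ?_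
      · change pc _ _ (yp _ u 0) * pc _ _ (yp _ u 1) = _
        rw [← map_mul]; rfl
      · simp [yb0, yb1, au]
    · refine cm_eq_one.2 ?_
      rw [hx2, hx3, ← map_mul]
      refine hz _ (yb2 _ * yb3 _) (zl false * zr false) ?_ ?_
      · change pc _ _ (yp _ u 2) * pc _ _ (yp _ u 3) = _
        rw [← map_mul]; rfl
      · simp [yb2, yb3]
    · refine cm_eq_one.2 ?_
      exact ht _ (wb0 _) w' hw3 (fun y => Iff.rfl)
    · refine cm_eq_one.2 ?_
      change Commute t (x ^ (q ^ 2))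
      rw [← map_pow]
      refine ht _ (yb0 _ u ^ (q ^ 2)) (zl true ^ (q ^ 2)) ?_ ?_
      · change pc _ _ (yp _ u 0) ^ _ = _
        rw [← map_pow]; rfl
      · intro y
        have : (yb0 (q ^ 2) u ^ (q ^ 2)) y = y := by
          rw [yb0_pow]
          have e : (((q ^ 2 : ℕ)) : ZMod (q ^ 2)) = 0 := ZMod.natCast_self _
          rw [e]
          simp [FreeGroup.map.id']
        rw [this]
    · refine cm_eq_one.2 ?_
      have := hskip 1 (by simpa using hnt)
      simpa using this
    · exact cm_eq_one.2 (hskip q hq)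
    · refine cm_eq_one.2 ?_
      rw [hx1, hx2, hx3, ← map_uW, ← map_mul]
      refine ht _ (yb2 _ * uW (o.map ZMod.val) (yb1 _) (yb3 _)) (zl false * uW (o.map ZMod.val) (zr true) (zr false)) ?_ ?_
      · have e1 : ∀ f1 f3 : Fin 4 → Equiv.Perm (YF (q ^ 2)), ∀ l, uW l f1 f3 0 = uW l (f1 0) (f3 0) :=
          fun f1 f3 l => map_uW (Pi.evalMonoidHom _ 0) l f1 f3
        rw [Pi.mul_apply, e1]
        change pc _ _ (yp _ u 2) * uW _ (pc _ _ (yp _ u 1)) (pc _ _ (yp _ u 3)) = _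
        rw [← map_uW, ← map_mul]
        congr 1
        refine Prod.ext ?_ ?_
        · change yb2 _ * MonoidHom.fst (Equiv.Perm (YB (q ^ 2))) (Equiv.Perm ZN) (uW _ (yp _ u 1) (yp _ u 3)) = _
          rw [map_uW]; rfl
        · change zl false * MonoidHom.snd (Equiv.Perm (YB (q ^ 2))) (Equiv.Perm ZN) (uW _ (yp _ u 1) (yp _ u 3)) = _
          rw [map_uW]; rfl
      · intro y
        rw [uW_bar _ _ inferInstance]
        exact PB_exec _ _ _
    · refine mul_inv_eq_one.2 (mul_inv_eq_iff_eq_mul.2 ?_)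
      change t * z = z ^ 2 * t
      rw [pow_two z]
      ext a : 1
      obtain ⟨j, y, i⟩ := a
      simp only [Equiv.Perm.mul_apply]
      by_cases hj : j = 0 ∧ D0 y
      · obtain ⟨rfl, hy⟩ := hj
        have e1 : ∀ i, z (0, y, i) = (0, y, i + 1) := fun i => cnd_pos _ _ _ hy i
        have e2 : ∀ i, t (0, y, i) = (0, y, -i) := fun i => cnd_pos _ _ _ (hD0P y hy) i
        rw [e1, e2, e2, e1, e1]
        congr 2
        revert i; decide
      · have e1 : ∀ i, z (j, y, i) = (j, y, i) := fun i => cnd_neg _ _ _ _ hj i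
        have e2 : ∃ i', t (j, y, i) = (j, y, i') := ⟨_, rfl⟩
        obtain ⟨i', e2⟩ := e2
        rw [e1, e2, e1, e1]
  · intro w htest
    have h1 : t * (cfgG p x w * z * (cfgG p x w)⁻¹) = (cfgG p x w * z ^ 2 * (cfgG p x w)⁻¹) * t :=
      mul_inv_eq_iff_eq_mul.1 (mul_inv_eq_one.1 htest)
    set W := cfgG p x w with hW
    have hWF : W = Fib _ (fun j => (w.map (fun b => if b then yF (q ^ 2) u (2 - j) else
        yF (q ^ 2) u (-j) * yF (q ^ 2) u (2 - j) * (yF (q ^ 2) u (-j))⁻¹)).prod) := by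
      have : (fun j => (w.map (fun b => if b then yF (q ^ 2) u (2 - j) else
        yF (q ^ 2) u (-j) * yF (q ^ 2) u (2 - j) * (yF (q ^ 2) u (-j))⁻¹)).prod) =
        (w.map (fun b => if b then (fun j => yF (q ^ 2) u (2 - j)) else
        (fun j => yF (q ^ 2) u (-j)) * (fun j => yF (q ^ 2) u (2 - j)) * (fun j => yF (q ^ 2) u (-j))⁻¹)).prod := by
        funext j
        have hev := fun l => map_list_prod (Pi.evalMonoidHom (fun _ : Fin 4 => Equiv.Perm (YF (q ^ 2))) j) l
        simp only [Pi.evalMonoidHom_apply] at hev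
        rw [hev, List.map_map]
        congr 1
        apply List.map_congr_left
        intro b _
        cases b <;> rfl
      rw [this, map_list_prod, List.map_map, hW, cfgG, hx2]
      congr 1
      apply List.map_congr_left
      intro b _
      cases b
      · simp only [Bool.false_eq_true, if_false, Function.comp, map_mul, map_inv]; rfl
      · rfl
    let W0 : YB (q ^ 2) := ((w.map (fun b => FreeGroup.of (if b then (0 : ZMod (q ^ 2)) else 1))).prod, 0, 0)
    obtain ⟨n, hWapp⟩ : ∃ n : ZN, ∀ i, W (0, ((1, 0, 0), 1), i) = (0, (W0, n), i) := by
      have : (w.map (fun b => if b then yF (q ^ 2) u 2 else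
        yF (q ^ 2) u 0 * yF (q ^ 2) u 2 * (yF (q ^ 2) u 0)⁻¹)).prod =
        pc _ _ ((w.map (fun b => if b then yb2 (q ^ 2) else yb0 (q ^ 2) u * yb2 (q ^ 2) * (yb0 (q ^ 2) u)⁻¹)).prod,
          (w.map (fun b => if b then zl false else zl true * zl false * (zl true)⁻¹)).prod) := by
        have : ∀ w : List Bool, (((w.map (fun b => if b then yb2 (q ^ 2) else yb0 (q ^ 2) u * yb2 (q ^ 2) * (yb0 (q ^ 2) u)⁻¹)).prod,
          (w.map (fun b => if b then zl false else zl true * zl false * (zl true)⁻¹)).prod) : _ × _) =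
          (w.map (fun b => if b then yp (q ^ 2) u 2 else yp (q ^ 2) u 0 * yp (q ^ 2) u 2 * (yp (q ^ 2) u 0)⁻¹)).prod := by
          intro w
          induction w with
          | nil => rfl
          | cons b w ih =>
            rw [List.map_cons, List.prod_cons, List.map_cons, List.prod_cons, List.map_cons, List.prod_cons, ← ih]
            cases b <;> rfl
        rw [this, map_list_prod, List.map_map]
        congr 1
        apply List.map_congr_left
        intro b _
        cases b <;> rfl
      refine ⟨(w.map (fun b => if b then zl false else zl true * zl false * (zl true)⁻¹)).prod 1, fun i => ?_⟩
      rw [hWF, Fib_apply]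
      simp only [neg_zero, sub_zero]
      rw [this, pc_apply, cfg_bar]
    have hWinv : ∀ i, W⁻¹ (0, (W0, n), i) = (0, ((1, 0, 0), 1), i) := by
      intro i
      rw [← hWapp i, perm_inv_apply]
    have hzz : ∀ i, z (0, ((1, 0, 0), 1), i) = (0, ((1, 0, 0), 1), i + 1) := fun i => cnd_pos D0 _ _ rfl i
    by_contra hnot
    have hDP : ¬ DP (W0, n) := by
      intro h
      apply hnot
      have h' : OrbP o _ 0 := h
      convert h'
      simp only [W0]
      rw [map_list_prod, List.map_map]
      have : ∀ l : List Bool, (l.map FreeGroup.of).prod = FreeGroup.mk (posL l) := by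
        intro l
        induction l with
        | nil => rfl
        | cons x l ih => rw [List.map_cons, List.prod_cons, ih, posL_cons]; rfl
      rw [← this]
      congr 1
      apply List.map_congr_left
      intro b _
      cases b <;> simp [hnt]
    have htt : ∀ i, t (0, (W0, n), i) = (0, (W0, n), i) := fun i => cnd_neg _ _ _ _ (fun h => hDP h.2) i
    have h2 := congrArg (fun f => f (0, (W0, n), 0)) h1
    simp only [Equiv.Perm.mul_apply, htt, hWinv, hzz, hWapp, pow_two z] at h2
    have h3 : (0 : ZMod 3) + 1 = 0 + 1 + 1 := congrArg (fun a => a.2.2) h2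
    revert h3
    decide

end final

end PartD
end WP


namespace WP

/-! ### Part E : completeness in any group satisfying the relations -/

section PartE

variable {G : Type*} [Group G]

lemma testG_one_iff {z t W : G} : testG z t W = 1 ↔ t * (W * z * W⁻¹) * t⁻¹ = W * z ^ 2 * W⁻¹ := by
  unfold testG
  rw [mul_inv_eq_one]

lemma testG_left {z t W A : G} (h : Commute t A) (hT : testG z t W = 1) : testG z t (A * W) = 1 := by
  rw [testG_one_iff] at *
  have h' : t * A = A * t := h
  have h'' : A⁻¹ * t⁻¹ = t⁻¹ * A⁻¹ := by rw [← mul_inv_rev, ← mul_inv_rev, h']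
  calc t * (A * W * z * (A * W)⁻¹) * t⁻¹ = (t * A) * (W * z * W⁻¹) * (A⁻¹ * t⁻¹) := by group
    _ = A * (t * (W * z * W⁻¹) * t⁻¹) * A⁻¹ := by rw [h', h'']; group
    _ = A * W * z ^ 2 * (A * W)⁻¹ := by rw [hT]; group

lemma testG_right {z t W B : G} (h : Commute z B) (hT : testG z t W = 1) : testG z t (W * B) = 1 := by
  rw [testG_one_iff] at *
  have h1 : B * z * B⁻¹ = z := by rw [mul_inv_eq_iff_eq_mul]; exact h.symm
  have h2 : B * z ^ 2 * B⁻¹ = z ^ 2 := by rw [mul_inv_eq_iff_eq_mul]; exact (h.pow_left 2).symm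
  calc t * (W * B * z * (W * B)⁻¹) * t⁻¹ = t * (W * (B * z * B⁻¹) * W⁻¹) * t⁻¹ := by group
    _ = W * (B * z ^ 2 * B⁻¹) * W⁻¹ := by rw [h1, h2, hT]
    _ = _ := by group

/-- evaluation of two letters -/
def h2 (a b : G) : FreeGroup Bool →* G := FreeGroup.lift (fun s => if s then a else b)

lemma h2_true (a b : G) : h2 a b (FreeGroup.of true) = a := by simp [h2]
lemma h2_false (a b : G) : h2 a b (FreeGroup.of false) = b := by simp [h2]

lemma h2_comm_one {a b c : G} (h1 : Commute a c) (h2' : Commute b c) (v : FreeGroup Bool) :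
    Commute (h2 a b v) c := by
  induction v using FreeGroup.induction_on with
  | C1 => simp
  | of s => cases s <;> simpa [h2_true, h2_false]
  | inv_of s ih => rw [map_inv]; exact ih.inv_left
  | mul x y hx hy => rw [map_mul]; exact hx.mul_left hy

lemma h2_comm {a b a' b' : G} (h11 : Commute a a') (h12 : Commute a b') (h21 : Commute b a')
    (h22 : Commute b b') (v w : FreeGroup Bool) : Commute (h2 a b v) (h2 a' b' w) :=
  (h2_comm_one (h2_comm_one h11 h21 v).symm (h2_comm_one h12 h22 v).symm w).symm

lemma h2_diag {a b a' b' z : G} (h11 : Commute a a') (h12 : Commute a b') (h21 : Commute b a')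
    (h22 : Commute b b') (hz1 : Commute z (a * a')) (hz2 : Commute z (b * b')) (v : FreeGroup Bool) :
    Commute z (h2 a b v * h2 a' b' v) := by
  have hc := h2_comm h11 h12 h21 h22
  induction v using FreeGroup.induction_on with
  | C1 => simp
  | of s => cases s <;> simpa [h2_true, h2_false]
  | inv_of s ih =>
    rw [map_inv, map_inv, ← mul_inv_rev, ← (hc _ _).eq]; exact ih.inv_right
  | mul x y hx hy =>
    have : h2 a b (x * y) * h2 a' b' (x * y) = (h2 a b x * h2 a' b' x) * (h2 a b y * h2 a' b' y) := by
      rw [map_mul, map_mul, mul_assoc, ← mul_assoc (h2 a b y), (hc y x).eq]; group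
    rw [this]
    exact hx.mul_right hy

def cph (f c : G) (n : ℤ) : G := f ^ n * c * (f ^ n)⁻¹

def Wd (f c : G) (Q : List ℤ) (S : ℤ) : G := (Q.map (cph f c)).prod * f ^ S

lemma Wd_mem (f c : G) (Q : List ℤ) (S : ℤ) : ∃ v, Wd f c Q S = h2 f c v := by
  refine ⟨Wd (FreeGroup.of true) (FreeGroup.of false) Q S, ?_⟩
  simp only [Wd, map_mul, map_list_prod, List.map_map, map_zpow, h2_true]
  congr 2
  apply List.map_congr_left
  intro n _
  simp [cph, h2_true, h2_false]

lemma Wd_uW (f c : G) (Q : List ℤ) (S : ℤ) (o : List ℕ) :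
    Wd f c Q S * uW o f c = Wd f c (Q ++ o.map (fun n : ℕ => S + (n : ℤ))) (S + 1) := by
  have h : ∀ o : List ℕ, f ^ S * (o.map (fun n => f ^ n * c * (f ^ n)⁻¹)).prod =
      ((o.map (fun n : ℕ => S + (n : ℤ))).map (cph f c)).prod * f ^ S := by
    intro o
    induction o with
    | nil => simp
    | cons n o ih =>
      simp only [List.map_cons, List.prod_cons]
      rw [mul_assoc (cph f c _), ← ih]
      simp only [cph, zpow_add, zpow_natCast]
      group
  rw [Wd, Wd, uW, List.map_append, List.prod_append, zpow_add, zpow_one]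
  calc _ = (Q.map (cph f c)).prod * (f ^ S * (o.map (fun n => f ^ n * c * (f ^ n)⁻¹)).prod) * f := by group
    _ = _ := by rw [h]; group

theorem complete (q g : ℕ) [NeZero (q ^ 2)] (u : (ZMod (q ^ 2))ˣ) (hg : (g : ZMod (q ^ 2)) = u)
    (hnt : (1 : ZMod (q ^ 2)) ≠ 0) (harith : ∀ n : ZMod (q ^ 2), n ≠ 0 → ∃ k : ℕ, n = (u : ZMod (q ^ 2)) ^ k ∨
      n = (q : ZMod (q ^ 2)) * (u : ZMod (q ^ 2)) ^ k)
    (o : List (ZMod (q ^ 2))) (z p x ω t : G)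
    (hrel : ∀ i, relG q g (o.map ZMod.val) z p x ω t i = 1) (w : List Bool)
    (hV : VTo o (fun S => S = 0) w 0) : testG z t (cfgG p x w) = 1 := by
  have r0 : p ^ 4 = 1 := hrel 0
  have r1 : Commute x (xk p x 1) := cm_eq_one.1 (hrel 1)
  have r2 : ω * x * ω⁻¹ = x ^ g := mul_inv_eq_one.1 (hrel 2)
  have r3 : Commute ω (xk p x 2 * xk p x 1) := cm_eq_one.1 (hrel 3)
  have r4 : Commute z (x * xk p x 1) := cm_eq_one.1 (hrel 4)
  have r5 : Commute z (xk p x 2 * xk p x 3) := cm_eq_one.1 (hrel 5)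
  have r6 : Commute t ω := cm_eq_one.1 (hrel 6)
  have r7 : Commute t (x ^ (q ^ 2)) := cm_eq_one.1 (hrel 7)
  have r8 : Commute t (x * (xk p x 2 * xk p x 1) * x⁻¹) := cm_eq_one.1 (hrel 8)
  have r9 : Commute t (x ^ q * (xk p x 2 * xk p x 1) * (x ^ q)⁻¹) := cm_eq_one.1 (hrel 9)
  have r10 : Commute t (xk p x 2 * uW (o.map ZMod.val) (xk p x 1) (xk p x 3)) := cm_eq_one.1 (hrel 10)
  have r11 : t * z * t⁻¹ = z ^ 2 := mul_inv_eq_one.1 (hrel 11)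
  have hxs : ∀ k, xk p x (k + 1) = MulAut.conj p (xk p x k) := by
    intro k; simp only [xk, MulAut.conj_apply, pow_succ']; group
  have hcs : ∀ k, Commute (xk p x k) (xk p x (k + 1)) → Commute (xk p x (k + 1)) (xk p x (k + 2)) := by
    intro k h
    rw [hxs (k + 1), hxs k]
    exact Commute.map (by rw [← hxs k]; exact h) (MulAut.conj p).toMonoidHom
  have x0 : xk p x 0 = x := by simp [xk]
  have x4 : xk p x 4 = x := by simp [xk, r0]
  have c01 : Commute (xk p x 0) (xk p x 1) := by rw [x0]; exact r1
  have c12 := hcs 0 c01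
  have c23 := hcs 1 c12
  have c34 := hcs 2 c23
  simp only [zero_add, Nat.reduceAdd] at c12 c23 c34
  rw [x4] at c34
  set c := xk p x 2 with hc
  set f' := xk p x 1 with hf'
  set c' := xk p x 3 with hc'
  have hcc := h2_comm r1 c34.symm c12.symm c23
  have hdiag := h2_diag r1 c34.symm c12.symm c23 r4 r5
  -- the skip elements
  have hs : ∀ n : ℤ, x ^ n * (c * f') * (x ^ n)⁻¹ = cph x c n * f' := by
    intro n
    have : Commute f' (x ^ n)⁻¹ := (r1.symm.zpow_right n).inv_right
    rw [cph, mul_assoc, mul_assoc c, this.eq]; group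
  have hs' : ∀ n m : ℤ, x ^ n * (cph x c m * f') * (x ^ n)⁻¹ = cph x c (n + m) * f' := by
    intro n m
    rw [← hs, ← hs, zpow_add]; group
  have hω : ∀ n : ℤ, ω * (cph x c n * f') * ω⁻¹ = cph x c (g * n) * f' := by
    intro n
    rw [← hs, ← hs]
    have e1 : ω * x ^ n * ω⁻¹ = x ^ (g * n) := by
      rw [← conj_zpow, r2, ← zpow_natCast, ← zpow_mul]
    have e2 : ω * (c * f') * ω⁻¹ = c * f' := by rw [mul_inv_eq_iff_eq_mul]; exact r3
    calc ω * (x ^ n * (c * f') * (x ^ n)⁻¹) * ω⁻¹ =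
        (ω * x ^ n * ω⁻¹) * (ω * (c * f') * ω⁻¹) * (ω * x ^ n * ω⁻¹)⁻¹ := by group
      _ = _ := by rw [e1, e2]
  have hconj : ∀ a b : G, Commute t a → Commute t b → Commute t (a * b * a⁻¹) :=
    fun a b ha hb => (ha.mul_right hb).mul_right ha.inv_right
  have hωk : ∀ (k : ℕ) (n : ℤ), Commute t (cph x c n * f') → Commute t (cph x c (g ^ k * n) * f') := by
    intro k
    induction k with
    | zero => intro n h; simpa using h
    | succ k ih =>
      intro n h
      have := hconj ω _ r6 (ih n h)
      rw [hω] at this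
      rwa [pow_succ', mul_assoc]
  have hβ : ∀ m : ℤ, Commute t (x ^ ((q ^ 2 : ℕ) * m)) := by
    intro m
    rw [zpow_mul, zpow_natCast]
    exact r7.zpow_right m
  have hβs : ∀ n n' : ℤ, (n : ZMod (q ^ 2)) = n' → ∃ m : ℤ, n' = (q ^ 2 : ℕ) * m + n := by
    intro n n' h
    have := (ZMod.intCast_eq_intCast_iff_dvd_sub n n' (q ^ 2)).1 h
    obtain ⟨m, hm⟩ := this
    exact ⟨m, by rw [← hm]; ring⟩
  have hmod : ∀ n n' : ℤ, (n : ZMod (q ^ 2)) = n' → Commute t (cph x c n * f') →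
      Commute t (cph x c n' * f') := by
    intro n n' h hn
    obtain ⟨m, rfl⟩ := hβs n n' h
    rw [← hs']
    exact hconj _ _ (hβ m) hn
  have hskip : ∀ n : ℤ, (n : ZMod (q ^ 2)) ≠ 0 → Commute t (cph x c n * f') := by
    intro n hn
    obtain ⟨k, hk | hk⟩ := harith n hn
    · refine hmod (g ^ k * 1) n ?_ (hωk k 1 ?_)
      · rw [hk]; simp [hg]
      · have := hs 1
        rw [zpow_one] at this
        rw [← this]; exact r8
    · refine hmod (g ^ k * q) n ?_ (hωk k q ?_)
      · rw [hk]; simp [hg, mul_comm]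
      · rw [← hs q, zpow_natCast]; exact r9
  set ol := o.map ZMod.val with hol
  have hu : ∀ a b : G, uW ol a b = h2 a b (uW ol (FreeGroup.of true) (FreeGroup.of false)) := by
    intro a b; rw [map_uW, h2_true, h2_false]
  have hexec : ∀ n : ℤ, (n : ZMod (q ^ 2)) = 0 → Commute t (cph x c n * uW ol f' c') := by
    intro n hn
    obtain ⟨m, hm⟩ := hβs 0 n (by simp [hn])
    rw [add_zero] at hm
    have e : cph x c n * uW ol f' c' = x ^ n * (c * uW ol f' c') * (x ^ n)⁻¹ := by
      have : Commute (uW ol f' c') (x ^ n)⁻¹ := by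
        refine (Commute.inv_right (Commute.zpow_right ?_ n))
        rw [hu]
        exact h2_comm_one r1.symm c34 _
      calc _ = x ^ n * c * ((x ^ n)⁻¹ * uW ol f' c') := by rw [cph]; group
        _ = _ := by rw [← this.eq]; group
    rw [e]
    exact hconj _ _ (by rw [hm]; exact hβ m) r10
  have main : ∀ (w : List Bool) (S : ZMod (q ^ 2)), VTo o (fun S => S = 0) w S → ∀ (Q : List ℤ) (S' : ℤ),
      Q.map (fun n : ℤ => decide ((n : ZMod (q ^ 2)) = 0)) = w → (S' : ZMod (q ^ 2)) = S →
      testG z t (Wd x c Q S') = 1 := by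
    intro w S h
    induction h with
    | nil S hS =>
      intro Q S' hQ hS'
      have : Q = [] := by simpa using hQ
      subst this
      obtain ⟨m, hm⟩ := hβs 0 S' (by rw [hS', hS]; simp)
      rw [add_zero] at hm
      have h1 : testG z t (1 : G) = 1 := by
        rw [testG_one_iff]; simpa using r11
      have := testG_left (hm ▸ hβ m : Commute t (x ^ S')) h1
      simpa [Wd] using this
    | step b w S _ ih =>
      intro Q S' hQ hS'
      cases Q with
      | nil => simp at hQ
      | cons n Q =>
        simp only [List.map_cons, List.cons.injEq] at hQ
        obtain ⟨hb, hQ⟩ := hQ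
        obtain ⟨v, hv⟩ := Wd_mem x c Q S'
        have hcons : Wd x c (n :: Q) S' = cph x c n * Wd x c Q S' := by simp [Wd, mul_assoc]
        cases b
        · have hn : (n : ZMod (q ^ 2)) ≠ 0 := by simpa using hb
          have h1 := ih Q (S' + 1) (by simp [hQ, vout]) (by push_cast; rw [hS'])
          have h2 := testG_right (B := (x * f')⁻¹) (r4.inv_right) h1
          have h3 := testG_left (hskip n hn) h2
          have e : cph x c n * f' * (Wd x c Q (S' + 1) * (x * f')⁻¹) = Wd x c (n :: Q) S' := by
            have e1 : Wd x c Q (S' + 1) = Wd x c Q S' * x := by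
              rw [Wd, Wd, zpow_add, zpow_one, mul_assoc]
            have e2 : Commute f' (Wd x c Q S') := by
              rw [hv]; exact (h2_comm_one r1 c12.symm v).symm
            rw [hcons, e1, r1.eq, mul_inv_rev]
            calc _ = cph x c n * (f' * Wd x c Q S') * f'⁻¹ := by group
              _ = _ := by rw [e2.eq]; group
          rwa [e] at h3
        · have hn : (n : ZMod (q ^ 2)) = 0 := by simpa using hb
          have h1 := ih (Q ++ ol.map (fun m : ℕ => S' + (m : ℤ))) (S' + 1) (by
              rw [List.map_append, hQ]
              congr 1
              simp only [vout, if_true, vblock, hol, List.map_map]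
              apply List.map_congr_left
              intro a _
              simp [hS']) (by push_cast; rw [hS'])
          rw [← Wd_uW] at h1
          have h2 := testG_right ((hdiag (uW ol (FreeGroup.of true) (FreeGroup.of false))).inv_right) h1
          have h3 := testG_left (hexec n hn) h2
          rw [← hu, ← hu] at h3
          have e2 : Commute (uW ol f' c') (Wd x c Q S') := by
            rw [hv, hu]; exact (hcc _ _).symm
          have e3 : Commute (uW ol x c) (uW ol f' c') := by
            rw [hu, hu]; exact hcc _ _
          have e : cph x c n * uW ol f' c' * (Wd x c Q S' * uW ol x c * (uW ol x c * uW ol f' c')⁻¹) =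
              Wd x c (n :: Q) S' := by
            rw [hcons, e3.eq, mul_inv_rev]
            calc _ = cph x c n * (uW ol f' c' * Wd x c Q S') * (uW ol f' c')⁻¹ := by group
              _ = _ := by rw [e2.eq]; group
          rwa [e] at h3
  have hcfg : cfgG p x w = Wd x c (w.map (fun b => if b then 0 else 1)) 0 := by
    simp only [cfgG, Wd, zpow_zero, mul_one, List.map_map]
    congr 1
    apply List.map_congr_left
    intro b _
    cases b <;> simp [cph, hc]
  rw [hcfg]
  refine main w 0 hV _ 0 ?_ (by simp)
  rw [List.map_map]
  conv_rhs => rw [← List.map_id w]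
  apply List.map_congr_left
  intro b _
  cases b <;> simp [hnt]

end PartE
end WP


namespace WP

/-! ### Part F : a queue system with labelled particles inside the binary queue system -/

section PartF
set_option linter.unusedSectionVars false
set_option linter.style.haveILetI false

/-- phases at which the `exec` letters of a word are going to be read -/
def labs {R : Type*} [CommRing R] : R → List Bool → List R
  | _, [] => []
  | S, b :: w => (if b then [S] else []) ++ labs (S + 1) w

lemma labs_append {R : Type*} [CommRing R] (w v : List Bool) : ∀ S : R,
    labs S (w ++ v) = labs S w ++ labs (S + w.length) v := by
  induction w with
  | nil => intro S; simp [labs]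
  | cons b w ih =>
    intro S
    simp only [List.cons_append, labs, ih, List.append_assoc, List.length_cons]
    push_cast
    rw [add_assoc S 1, add_comm (1 : R)]

lemma labs_none {R : Type*} [CommRing R] (w : List Bool) : ∀ S : R, (∀ b ∈ w, b = false) → labs S w = [] := by
  induction w with
  | nil => intro S _; rfl
  | cons b w ih =>
    intro S h
    have hb := h b (by simp)
    subst hb
    simp only [labs]
    rw [ih _ (fun b hb => h b (by simp [hb]))]
    simp

lemma labs_single {R : Type*} [CommRing R] (n r : ℕ) (hr : r < n) (S : R) :
    labs S ((List.range n).map (fun i => decide (i = r))) = [S + r] := by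
  obtain ⟨k, rfl⟩ := Nat.exists_eq_add_of_lt hr
  have e : List.range (r + k + 1) = List.range r ++ (r :: (List.range k).map (fun j => r + 1 + j)) := by
    rw [show r + k + 1 = r + (k + 1) by ring, List.range_add, List.range_succ_eq_map]
    simp only [List.map_cons, List.map_map, add_zero]
    congr 2
    apply List.map_congr_left
    intro j _
    simp; ring
  rw [e, List.map_append, labs_append, labs_none, List.map_cons]
  · simp only [labs, decide_true, if_true, List.nil_append, List.length_map, List.length_range]
    rw [labs_none]
    · rfl
    · intro b hb
      simp only [List.map_map, List.mem_map] at hb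
      obtain ⟨j, _, rfl⟩ := hb
      simp; omega
  · intro b hb
    simp only [List.mem_map, List.mem_range] at hb
    obtain ⟨j, hj, rfl⟩ := hb
    simp; omega

variable (q : ℕ) [NeZero q] {A : Type*} [Fintype A] [DecidableEq A]
  (enc : A → ℕ) (Tab : A → ZMod q → List (A × ZMod q))

/-- the queue system with labelled particles -/
inductive UTo (T : ZMod q → Prop) : List (A × ZMod q) → ZMod q → Prop
  | nil (c : ZMod q) : T c → UTo T [] c
  | step (a : A) (ρ : ZMod q) (P : List (A × ZMod q)) (c : ZMod q) :
      UTo T (P ++ (Tab a ρ).map (fun x => (x.1, x.2 + c))) (c + 1) → UTo T ((a, ρ) :: P) c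

def qm (ρ : ZMod q) : ZMod (q ^ 2) := ((q * ρ.val : ℕ) : ZMod (q ^ 2))

lemma qm_add (ρ σ : ZMod q) : qm q (ρ + σ) = qm q ρ + qm q σ := by
  unfold qm
  rw [ZMod.val_add, ← Nat.cast_add, ← mul_add]
  rw [ZMod.natCast_eq_natCast_iff, pow_two]
  exact Nat.ModEq.mul_left' q (Nat.mod_modEq _ _)

lemma qm_one (h : 1 < q) : qm q 1 = (q : ZMod (q ^ 2)) := by
  haveI : Fact (1 < q) := ⟨h⟩
  simp [qm, ZMod.val_one]

def labN (x : A × ZMod q) : ℕ := enc x.1 + q * x.2.val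
def lab (x : A × ZMod q) : ZMod (q ^ 2) := (labN q enc x : ℕ)

lemma lab_add (a : A) (ρ c : ZMod q) : lab q enc (a, ρ + c) = qm q c + lab q enc (a, ρ) := by
  have := qm_add q ρ c
  unfold qm at this
  simp only [lab, labN, Nat.cast_add] at *
  rw [this, qm]; ring

variable {enc}
lemma labN_lt (hlt : ∀ a, enc a + 2 < q) (x : A × ZMod q) : labN q enc x < q ^ 2 := by
  have h1 := hlt x.1
  have h2 := ZMod.val_lt x.2
  unfold labN
  have : q * x.2.val ≤ q * (q - 1) := Nat.mul_le_mul_left _ (by omega)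
  have h3 : q * (q - 1) + q = q ^ 2 := by
    obtain ⟨k, hk⟩ : ∃ k, q = k + 1 := ⟨q - 1, by omega⟩
    rw [hk]; simp; ring
  omega

lemma lab_inj (hlt : ∀ a, enc a + 2 < q) (hinj : Function.Injective enc) :
    Function.Injective (lab q enc) := by
  intro x y h
  have h1 : labN q enc x = labN q enc y := by
    have := congrArg ZMod.val h
    rwa [lab, lab, ZMod.val_natCast_of_lt (labN_lt q hlt x), ZMod.val_natCast_of_lt (labN_lt q hlt y)] at this
  have hx := hlt x.1
  have hy := hlt y.1
  unfold labN at h1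
  have e1 : enc x.1 = enc y.1 := by
    have := congrArg (· % q) h1
    simpa [Nat.add_mul_mod_self_left, Nat.mod_eq_of_lt (show enc x.1 < q by omega),
      Nat.mod_eq_of_lt (show enc y.1 < q by omega)] using this
  have e2 : x.2.val = y.2.val := by
    rw [e1] at h1
    exact Nat.eq_of_mul_eq_mul_left (NeZero.pos q) (Nat.add_left_cancel h1)
  exact Prod.ext (hinj e1) (ZMod.val_injective q e2)

def fillv (i : ℕ) : ZMod (q ^ 2) := if i % q = q - 1 then -((q - 2 : ℕ) : ZMod (q ^ 2)) else -((q - 1 : ℕ) : ZMod (q ^ 2))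

def oblk (x : ZMod (q ^ 2) × ℕ) : List (ZMod (q ^ 2)) :=
  (List.range (q ^ 2)).map (fun i => if i = x.2 then -x.1 else fillv q i)

variable (enc)
noncomputable def prs : List (ZMod (q ^ 2) × ℕ) :=
  (Finset.univ : Finset (A × ZMod q)).toList.flatMap
    (fun x => (Tab x.1 x.2).map (fun y => (lab q enc x, labN q enc y)))

noncomputable def oList : List (ZMod (q ^ 2)) := (prs q enc Tab).flatMap (oblk q) ++ (List.range q).map (fillv q)
variable {enc}

/-- reduction to `ZMod q` -/
def pq : ZMod (q ^ 2) →+* ZMod q := ZMod.castHom (dvd_pow_self q two_ne_zero) (ZMod q)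

lemma pq_nat (n : ℕ) : pq q (n : ZMod (q ^ 2)) = n := by simp

lemma fill_ne (hlt : ∀ a, enc a + 2 < q) (x : A × ZMod q) (i : ℕ) : fillv q i ≠ - lab q enc x := by
  intro h
  have h1 := congrArg (pq q) h
  have hx := hlt x.1
  have h2 : pq q (lab q enc x) = (enc x.1 : ZMod q) := by
    rw [lab, pq_nat, labN]; push_cast; simp
  rw [map_neg, h2, fillv] at h1
  have key : ∀ m : ℕ, m < q → m ≠ enc x.1 → -(m : ZMod q) ≠ - (enc x.1 : ZMod q) := by
    intro m hm hne hh
    rw [neg_inj, ZMod.natCast_eq_natCast_iff'] at hh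
    rw [Nat.mod_eq_of_lt hm, Nat.mod_eq_of_lt (by omega)] at hh
    exact hne hh
  split_ifs at h1
  · rw [map_neg, pq_nat] at h1
    exact key _ (by omega) (by omega) h1
  · rw [map_neg, pq_nat] at h1
    exact key _ (by omega) (by omega) h1

lemma vblock_append {R : Type*} [CommRing R] [DecidableEq R] (o o' : List R) (S : R) :
    vblock o S ++ vblock o' S = vblock (o ++ o') S := by simp [vblock]

lemma labs_vblock_aux (hlt : ∀ a, enc a + 2 < q) (x : A × ZMod q) (l : List (ZMod (q ^ 2) × ℕ))
    (hl : ∀ y ∈ l, y.2 < q ^ 2) : ∀ E : ZMod (q ^ 2),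
    labs E (vblock (l.flatMap (oblk q) ++ (List.range q).map (fillv q)) (lab q enc x)) =
      (l.filter (fun y => decide (y.1 = lab q enc x))).map (fun y => E + y.2) := by
  have hne : ∀ i, lab q enc x + fillv q i ≠ 0 := by
    intro i h
    exact fill_ne q hlt x i (eq_neg_of_add_eq_zero_right h)
  induction l with
  | nil =>
    intro E
    simp only [List.flatMap_nil, List.nil_append, List.filter_nil, List.map_nil]
    apply labs_none
    intro b hb
    simp only [vblock, List.map_map, List.mem_map] at hb
    obtain ⟨i, _, rfl⟩ := hb
    simp [hne]
  | cons y l ih =>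
    intro E
    rw [List.flatMap_cons, List.append_assoc, ← vblock_append, labs_append,
      ih (fun y hy => hl y (by simp [hy]))]
    have hlen : ((vblock (oblk q y) (lab q enc x)).length : ZMod (q ^ 2)) = 0 := by
      simp only [vblock, oblk, List.length_map, List.length_range]
      exact ZMod.natCast_self _
    rw [hlen, add_zero]
    by_cases h : y.1 = lab q enc x
    · have : vblock (oblk q y) (lab q enc x) = (List.range (q ^ 2)).map (fun i => decide (i = y.2)) := by
        simp only [vblock, oblk, List.map_map]
        apply List.map_congr_left
        intro i _
        by_cases hi : i = y.2
        · simp [hi, h]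
        · simp [hi, hne]
      rw [this, labs_single _ _ (hl y (by simp))]
      simp [h]
    · have : labs E (vblock (oblk q y) (lab q enc x)) = [] := by
        apply labs_none
        intro b hb
        simp only [vblock, oblk, List.map_map, List.mem_map] at hb
        obtain ⟨i, _, rfl⟩ := hb
        by_cases hi : i = y.2
        · simp only [Function.comp, hi, if_true, decide_eq_false_iff_not, ← sub_eq_add_neg, sub_eq_zero]
          exact fun hh => h hh.symm
        · simp [hi, hne]
      rw [this]
      simp [h]

lemma prs_lt (hlt : ∀ a, enc a + 2 < q) : ∀ y ∈ prs q enc Tab, y.2 < q ^ 2 := by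
  intro y hy
  simp only [prs, List.mem_flatMap, List.mem_map] at hy
  obtain ⟨x, _, z, _, rfl⟩ := hy
  exact labN_lt q hlt z

lemma filter_flatMap_single {α β : Type*} (p : β → Bool) (f : α → List β) (x : α)
    (l : List α) (hn : l.Nodup) (hx : x ∈ l) (h1 : ∀ b ∈ f x, p b = true)
    (h2 : ∀ y, y ≠ x → ∀ b ∈ f y, p b = false) : (l.flatMap f).filter p = f x := by
  have h0 : ∀ l : List α, x ∉ l → (l.flatMap f).filter p = [] := by
    intro l hl
    rw [List.filter_eq_nil_iff]
    intro b hb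
    rw [List.mem_flatMap] at hb
    obtain ⟨y, hy, hb⟩ := hb
    simp [h2 y (fun h => hl (h ▸ hy)) b hb]
  induction l with
  | nil => simp at hx
  | cons y l ih =>
    rw [List.flatMap_cons, List.filter_append]
    rw [List.nodup_cons] at hn
    by_cases h : y = x
    · subst h
      rw [h0 l hn.1, List.append_nil, List.filter_eq_self.2 h1]
    · rw [ih hn.2 (by simpa [Ne.symm h] using hx)]
      rw [List.filter_eq_nil_iff.2, List.nil_append]
      intro b hb
      simp [h2 y h b hb]

lemma labs_vblock (hlt : ∀ a, enc a + 2 < q) (hinj : Function.Injective enc) (x : A × ZMod q) (c : ZMod q) :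
    labs (qm q c) (vblock (oList q enc Tab) (lab q enc x)) =
      ((Tab x.1 x.2).map (fun y => (y.1, y.2 + c))).map (lab q enc) := by
  rw [oList, labs_vblock_aux q hlt x _ (prs_lt q Tab hlt), prs,
    filter_flatMap_single _ _ x _ (Finset.nodup_toList _) (by simp)]
  · rw [List.map_map, List.map_map]
    apply List.map_congr_left
    rintro ⟨a, ρ⟩ _
    simp only [Function.comp, lab_add]
    rfl
  · intro b hb
    simp only [List.mem_map] at hb
    obtain ⟨y, _, rfl⟩ := hb
    simp
  · intro y hy b hb
    simp only [List.mem_map] at hb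
    obtain ⟨z, _, rfl⟩ := hb
    simp only [decide_eq_false_iff_not]
    exact fun h => hy (lab_inj q hlt hinj h)

lemma oblk_len (l : List (ZMod (q ^ 2) × ℕ)) : (l.flatMap (oblk q)).length = q ^ 2 * l.length := by
  induction l with
  | nil => simp
  | cons y l ih => rw [List.flatMap_cons, List.length_append, ih]; simp [oblk]; ring

lemma oList_len : (oList q enc Tab).length = q ^ 2 * (prs q enc Tab).length + q := by
  rw [oList, List.length_append, oblk_len]; simp

lemma oList_len_q : (((oList q enc Tab).length : ℕ) : ZMod q) = 0 := by
  rw [oList_len]; simp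

lemma oList_len_q2 : (((oList q enc Tab).length : ℕ) : ZMod (q ^ 2)) = q := by
  rw [oList_len]; push_cast
  have : ((q : ZMod (q ^ 2)) ^ 2) = 0 := by exact_mod_cast ZMod.natCast_self (q ^ 2)
  rw [this]; simp

lemma fill_good (h2 : 2 < q) (i : ℕ) : pq q (fillv q i) + (i : ZMod q) ≠ 0 := by
  have hi : (i : ZMod q) = ((i % q : ℕ) : ZMod q) := by simp
  have hlt := Nat.mod_lt i (by omega : 0 < q)
  rw [hi, fillv]
  have key : ∀ a b : ℕ, a < q → b < q → a ≠ b → -(a : ZMod q) + b ≠ 0 := by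
    intro a b ha hb hab h
    rw [neg_add_eq_zero, ZMod.natCast_eq_natCast_iff', Nat.mod_eq_of_lt ha, Nat.mod_eq_of_lt hb] at h
    exact hab h
  split_ifs with h
  · rw [map_neg, pq_nat]
    exact key _ _ (by omega) hlt (by omega)
  · rw [map_neg, pq_nat]
    exact key _ _ (by omega) hlt (by omega)

lemma oList_good (hq : 2 < q) (hlt : ∀ a, enc a + 2 < q) (hinj : Function.Injective enc)
    (hch : ∀ a ρ, ∀ y ∈ Tab a ρ, y.1 ≠ a) (t : ℕ) (ht : t < (oList q enc Tab).length) :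
    pq q (oList q enc Tab)[t] + (t : ZMod q) ≠ 0 := by
  -- a general statement about lists
  let good (l : List (ZMod (q ^ 2))) : Prop := ∀ t (h : t < l.length), pq q l[t] + (t : ZMod q) ≠ 0
  have happ : ∀ l l' : List (ZMod (q ^ 2)), ((l.length : ℕ) : ZMod q) = 0 → good l → good l' → good (l ++ l') := by
    intro l l' h0 h1 h2 t ht
    by_cases h : t < l.length
    · rw [List.getElem_append_left h]; exact h1 t h
    · have hh : t - l.length < l'.length := by rw [List.length_append] at ht; omega
      rw [List.getElem_append_right (by omega)]
      have := h2 _ hh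
      rwa [Nat.cast_sub (by omega), h0, sub_zero] at this
  have hfill : good ((List.range q).map (fillv q)) := by
    intro t ht
    rw [List.getElem_map, List.getElem_range]
    exact fill_good q hq t
  have hblk : ∀ y ∈ prs q enc Tab, good (oblk q y) := by
    intro y hy t ht
    simp only [prs, List.mem_flatMap, List.mem_map] at hy
    obtain ⟨⟨a, ρ⟩, _, ⟨a', ρ'⟩, hm, rfl⟩ := hy
    simp only [oblk, List.getElem_map, List.getElem_range]
    split_ifs with h
    · subst h
      rw [map_neg, lab, pq_nat]
      intro h
      rw [neg_add_eq_zero] at h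
      have hx := hlt a
      have hy := hlt a'
      simp only [labN] at h
      push_cast at h
      simp only [CharP.cast_eq_zero, zero_mul, add_zero] at h
      rw [ZMod.natCast_eq_natCast_iff', Nat.mod_eq_of_lt (by omega), Nat.mod_eq_of_lt (by omega)] at h
      exact hch a ρ _ hm (hinj h).symm
    · exact fill_good q hq t
  have hall : ∀ l : List (ZMod (q ^ 2) × ℕ), (∀ y ∈ l, good (oblk q y)) → good (l.flatMap (oblk q)) := by
    intro l
    induction l with
    | nil => intro _ t ht; simp at ht
    | cons y l ih =>
      intro h
      rw [List.flatMap_cons]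
      refine happ _ _ ?_ (h y (by simp)) (ih (fun z hz => h z (by simp [hz])))
      simp [oblk]
  exact happ _ _ (by rw [oblk_len]; simp) (hall _ hblk) hfill t ht

lemma VTo_of_UTo (hq : 2 < q) (hlt : ∀ a, enc a + 2 < q) (hinj : Function.Injective enc)
    (P : List (A × ZMod q)) (c : ZMod q) (h : UTo q Tab (fun c => c = 0) P c) :
    ∀ (w : List Bool) (S : ZMod (q ^ 2)), labs S w = P.map (lab q enc) → S + w.length = qm q c →
      VTo (oList q enc Tab) (fun S => S = 0) w S := by
  induction h with
  | nil c hc =>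
    intro w
    induction w with
    | nil =>
      intro S _ h
      apply VTo.nil
      subst hc
      simpa [qm] using h
    | cons b w ih =>
      intro S h1 h2
      cases b
      · apply VTo.step
        simp only [vout, Bool.false_eq_true, if_false, List.append_nil]
        apply ih
        · simpa [labs] using h1
        · rw [← h2]; push_cast [List.length_cons]; ring
      · simp [labs] at h1
  | step a ρ P c _ ih =>
    intro w
    induction w with
    | nil => intro S h1; simp [labs] at h1
    | cons b w ihw =>
      intro S h1 h2
      have h2' : S + 1 + w.length = qm q c := by rw [← h2]; push_cast [List.length_cons]; ring
      cases b
      · apply VTo.step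
        simp only [vout, Bool.false_eq_true, if_false, List.append_nil]
        apply ihw
        · simpa [labs] using h1
        · exact h2'
      · simp only [labs, if_true, List.cons_append, List.nil_append, List.map_cons, List.cons.injEq] at h1
        apply VTo.step
        simp only [vout, if_true]
        apply ih
        · rw [labs_append, h2', h1.1, labs_vblock q Tab hlt hinj, List.map_append, ← h1.2, h1.1]
        · rw [List.length_append, qm_add, qm_one q (by omega), ← h2']
          rw [show (vblock (oList q enc Tab) S).length = (oList q enc Tab).length by simp [vblock]]
          push_cast
          rw [oList_len_q2]; ring

lemma UTo_of_VTo (hq : 2 < q) (hlt : ∀ a, enc a + 2 < q) (hinj : Function.Injective enc)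
    (w : List Bool) (S : ZMod (q ^ 2)) (h : VTo (oList q enc Tab) (fun _ => True) w S) :
    ∀ (P : List (A × ZMod q)) (c : ZMod q), labs S w = P.map (lab q enc) → S + w.length = qm q c →
      UTo q Tab (fun _ => True) P c := by
  induction h with
  | nil S _ =>
    intro P c h1 _
    have : P = [] := by simpa [labs] using h1.symm
    subst this
    exact UTo.nil _ trivial
  | step b w S _ ih =>
    intro P c h1 h2
    have h2' : S + 1 + w.length = qm q c := by rw [← h2]; push_cast [List.length_cons]; ring
    cases b
    · simp only [vout, Bool.false_eq_true, if_false, List.append_nil] at ih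
      apply ih
      · simpa [labs] using h1
      · exact h2'
    · cases P with
      | nil => simp [labs] at h1
      | cons x P =>
        obtain ⟨a, ρ⟩ := x
        simp only [labs, if_true, List.cons_append, List.nil_append, List.map_cons, List.cons.injEq] at h1
        apply UTo.step
        simp only [vout, if_true] at ih
        apply ih
        · rw [labs_append, h2', h1.1, labs_vblock q Tab hlt hinj, List.map_append, ← h1.2, h1.1]
        · rw [List.length_append, qm_add, qm_one q (by omega), ← h2']
          rw [show (vblock (oList q enc Tab) S).length = (oList q enc Tab).length by simp [vblock]]
          push_cast
          rw [oList_len_q2]; ring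

variable (enc)
/-- a particle as a block of bits -/
def pblk (x : A × ZMod q) : List Bool := (List.range (q ^ 2)).map (fun i => decide (i = labN q enc x))
variable {enc}

lemma labs_init (hlt : ∀ a, enc a + 2 < q) (P : List (A × ZMod q)) :
    labs (0 : ZMod (q ^ 2)) (P.flatMap (pblk q enc)) = P.map (lab q enc) := by
  induction P with
  | nil => rfl
  | cons x P ih =>
    rw [List.flatMap_cons, labs_append]
    have : (((pblk q enc x).length : ℕ) : ZMod (q ^ 2)) = 0 := by
      simp only [pblk, List.length_map, List.length_range]; exact ZMod.natCast_self _
    rw [this, add_zero, ih, pblk, labs_single _ _ (labN_lt q hlt x)]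
    simp [lab]

lemma pblk_len (P : List (A × ZMod q)) : (P.flatMap (pblk q enc)).length = q ^ 2 * P.length := by
  induction P with
  | nil => simp
  | cons y l ih => rw [List.flatMap_cons, List.length_append, ih]; simp [pblk]; ring

theorem V_init_of_U (hq : 2 < q) (hlt : ∀ a, enc a + 2 < q) (hinj : Function.Injective enc)
    (P : List (A × ZMod q)) (h : UTo q Tab (fun c => c = 0) P 0) :
    VTo (oList q enc Tab) (fun S => S = 0) (P.flatMap (pblk q enc)) 0 := by
  refine VTo_of_UTo q Tab hq hlt hinj P 0 h _ _ (labs_init q hlt P) ?_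
  rw [pblk_len, Nat.cast_mul, ZMod.natCast_self]; simp [qm]

theorem U_of_V_init (hq : 2 < q) (hlt : ∀ a, enc a + 2 < q) (hinj : Function.Injective enc)
    (P : List (A × ZMod q)) (h : VTo (oList q enc Tab) (fun _ => True) (P.flatMap (pblk q enc)) 0) :
    UTo q Tab (fun _ => True) P 0 := by
  refine UTo_of_VTo q Tab hq hlt hinj _ _ h P 0 (labs_init q hlt P) ?_
  rw [pblk_len, Nat.cast_mul, ZMod.natCast_self]; simp [qm]

end PartF
end WP


namespace WP

/-! ### Part G : stack machines inside the particle queue system -/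

section PartG
set_option linter.unusedSectionVars false
set_option linter.unusedSimpArgs false
open StateTransition

inductive Ins (Q I Γ : Type) : Type
  | jump (s : Q) : Ins Q I Γ
  | push (i : I) (γ : Γ) (s : Q) : Ins Q I Γ
  | pop (i : I) (f : Option Γ → Q) : Ins Q I Γ
  | halt : Ins Q I Γ

variable {Q I Γ : Type} [DecidableEq I]

/-- one step of a stack machine; `none` is the terminal configuration -/
def sstep (prog : Q → Ins Q I Γ) : Option (Q × (I → List Γ)) → Option (Option (Q × (I → List Γ)))
  | none => none
  | some (s, st) => some (match prog s with
    | .jump s' => some (s', st)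
    | .push i γ s' => some (s', Function.update st i (γ :: st i))
    | .pop i f => some (f (st i).head?, Function.update st i (st i).tail)
    | .halt => none)

section ustep
variable (q : ℕ) {A : Type*} (Tab : A → ZMod q → List (A × ZMod q))

def ustep : List (A × ZMod q) × ZMod q → Option (List (A × ZMod q) × ZMod q)
  | ([], _) => none
  | ((a, ρ) :: P, c) => some (P ++ (Tab a ρ).map (fun x => (x.1, x.2 + c)), c + 1)

lemma UTo_of_eval (T : ZMod q → Prop) (x : List (A × ZMod q) × ZMod q) (c : ZMod q)
    (h : ([], c) ∈ eval (ustep q Tab) x) (hc : T c) : UTo q Tab T x.1 x.2 := by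
  replace h := (mem_eval.1 h).1
  induction h using Relation.ReflTransGen.head_induction_on with
  | refl => exact UTo.nil _ hc
  | @head a b hab _ ih =>
    obtain ⟨P, d⟩ := a
    cases P with
    | nil => simp [ustep] at hab
    | cons y P =>
      obtain ⟨a, ρ⟩ := y
      simp only [ustep, Option.mem_def, Option.some.injEq] at hab
      subst hab
      exact UTo.step _ _ _ _ ih

lemma eval_of_UTo (T : ZMod q → Prop) (P : List (A × ZMod q)) (c : ZMod q) (h : UTo q Tab T P c) :
    (eval (ustep q Tab) (P, c)).Dom := by
  induction h with
  | nil c _ =>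
    rw [Part.dom_iff_mem]
    exact ⟨([], c), mem_eval.2 ⟨Relation.ReflTransGen.refl, rfl⟩⟩
  | step a ρ P c _ ih =>
    rw [reaches_eval (b := (P ++ (Tab a ρ).map (fun x => (x.1, x.2 + c)), c + 1))]
    · exact ih
    · exact Relation.ReflTransGen.single rfl

/-- output of a whole pass -/
def outp : List (A × ZMod q) → ZMod q → List (A × ZMod q)
  | [], _ => []
  | (a, ρ) :: P, c => (Tab a ρ).map (fun x => (x.1, x.2 + c)) ++ outp P (c + 1)

lemma outp_append (X Y : List (A × ZMod q)) : ∀ c,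
    outp q Tab (X ++ Y) c = outp q Tab X c ++ outp q Tab Y (c + X.length) := by
  induction X with
  | nil => intro c; simp [outp]
  | cons x X ih =>
    obtain ⟨a, ρ⟩ := x
    intro c
    simp only [List.cons_append, outp, ih, List.append_assoc, List.length_cons]
    push_cast
    rw [add_assoc c 1, add_comm (1 : ZMod q)]

lemma pass_reaches (P : List (A × ZMod q)) : ∀ (R : List (A × ZMod q)) c,
    Reaches (ustep q Tab) (P ++ R, c) (R ++ outp q Tab P c, c + P.length) := by
  induction P with
  | nil => intro R c; simp only [outp, List.nil_append, List.append_nil, List.length_nil, Nat.cast_zero, add_zero]; exact Relation.ReflTransGen.refl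
  | cons x P ih =>
    obtain ⟨a, ρ⟩ := x
    intro R c
    refine Relation.ReflTransGen.head (b := (P ++ (R ++ (Tab a ρ).map (fun x => (x.1, x.2 + c))), c + 1)) ?_ ?_
    · simp [ustep]
    · have := ih (R ++ (Tab a ρ).map (fun x => (x.1, x.2 + c))) (c + 1)
      simp only [outp, List.length_cons]
      push_cast
      rw [add_comm (P.length : ZMod q), ← add_assoc, ← List.append_assoc R]
      exact this

lemma pass (P : List (A × ZMod q)) (c : ZMod q) :
    Reaches (ustep q Tab) (P, c) (outp q Tab P c, c + P.length) := by
  simpa using pass_reaches q Tab P [] c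

lemma pass1 (P : List (A × ZMod q)) (c : ZMod q) (hP : P ≠ []) :
    Reaches₁ (ustep q Tab) (P, c) (outp q Tab P c, c + P.length) := by
  rcases Relation.reflTransGen_iff_eq_or_transGen.1 (pass q Tab P c) with h | h
  · cases P with
    | nil => exact absurd rfl hP
    | cons x P =>
      refine Relation.TransGen.head' (b := (P ++ (Tab x.1 x.2).map (fun x => (x.1, x.2 + c)), c + 1)) rfl ?_
      obtain ⟨a, ρ⟩ := x
      have := pass_reaches q Tab P ((Tab a ρ).map (fun x => (x.1, x.2 + c))) (c + 1)
      simp only [outp, List.length_cons]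
      push_cast
      rw [add_comm (P.length : ZMod q), ← add_assoc]
      exact this
  · exact h

lemma outp_flatMap {X : Type*} (b : X → List (A × ZMod q)) (c : ZMod q) (l : List X)
    (hb : ∀ x, (((b x).length : ℕ) : ZMod q) = 0) :
    outp q Tab (l.flatMap b) c = l.flatMap (fun x => outp q Tab (b x) c) := by
  induction l with
  | nil => simp [outp]
  | cons x l ih => rw [List.flatMap_cons, outp_append, hb, add_zero, ih, List.flatMap_cons]

lemma len_flatMap {X : Type*} (b : X → List (A × ZMod q)) (l : List X)
    (hb : ∀ x, (((b x).length : ℕ) : ZMod q) = 0) : (((l.flatMap b).length : ℕ) : ZMod q) = 0 := by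
  induction l with
  | nil => simp
  | cons x l ih => rw [List.flatMap_cons, List.length_append, Nat.cast_add, hb, ih, add_zero]

end ustep

abbrev Al (Q I : Type) : Type := Option (Bool × Bool × Q × Option I)

variable (q : ℕ)

def blk (a : Al Q I) (ρ : ZMod q) (w : ℕ) : List (Al Q I × ZMod q) :=
  (a, ρ) :: List.replicate (w - 1) (none, ρ)

lemma blk_len (a : Al Q I) (ρ : ZMod q) (w : ℕ) (hw : 1 ≤ w) : (blk q a ρ w).length = w := by
  simp [blk]; omega

lemma blk_map (a : Al Q I) (ρ : ZMod q) (w : ℕ) (c : ZMod q) :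
    (blk q a ρ w).map (fun x => (x.1, x.2 + c)) = blk q a (ρ + c) w := by
  simp [blk]

variable (prog : Q → Ins Q I Γ) (dig : Γ → ℕ) (dec : ZMod q → Option Γ)

def wid (s : Q) (τ : Option I) : ℕ :=
  match prog s with
  | .pop i _ => if τ = some i then 1 else q
  | _ => q

def newB (s : Q) (τ : Option I) : List (Al Q I × ZMod q) :=
  blk q (some (false, false, s, τ)) 0 (wid q prog s τ)

def gpush (i : I) (γ : Γ) : Option I → List (Option I)
  | none => none :: List.replicate (dig γ) (some i)
  | some j => if j = i then List.replicate q (some i) else [some j]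

def tab : Al Q I → ZMod q → List (Al Q I × ZMod q)
  | none, _ => []
  | some (false, false, s, τ), _ =>
    match prog s with
    | .jump _ => blk q (some (false, true, s, τ)) 0 q
    | .push _ _ _ => blk q (some (false, true, s, τ)) 0 q
    | .pop i _ => blk q (some (true, false, s, τ)) 0 (if τ = some i then q - 1 else q)
    | .halt => []
  | some (false, true, s, τ), _ =>
    match prog s with
    | .jump s' => newB q prog s' τ
    | .push i γ s' => (gpush q dig i γ τ).flatMap (newB q prog s')
    | _ => []
  | some (true, false, s, τ), κ =>
    match prog s with
    | .pop i _ => if τ = some i ∧ κ ≠ -1 then [] else blk q (some (true, true, s, τ)) κ q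
    | _ => []
  | some (true, true, s, τ), σ =>
    match prog s with
    | .pop _ f => newB q prog (f (dec σ)) τ
    | _ => []


lemma tab_child (a : Al Q I) (ρ : ZMod q) : ∀ y ∈ (tab q prog dig dec) a ρ, y.1 ≠ a := by
  have hb : ∀ (b : Bool × Bool × Q × Option I) (r : ZMod q) w (a : Bool × Bool × Q × Option I),
      b ≠ a → ∀ y ∈ blk q (some b) r w, y.1 ≠ some a := by
    intro b r w a hba y hy
    simp only [blk, List.mem_cons, List.mem_replicate] at hy
    rcases hy with rfl | ⟨_, rfl⟩
    · simpa using hba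
    · simp
  match a with
  | none => simp [tab]
  | some (false, false, s, τ) =>
    simp only [tab]
    cases prog s <;> first | (intro y hy; simp at hy; done) | (apply hb; simp)
  | some (false, true, s, τ) =>
    simp only [tab]
    cases prog s with
    | jump s' => apply hb; simp
    | push i γ s' =>
      intro y hy
      rw [List.mem_flatMap] at hy
      obtain ⟨τ', _, hy⟩ := hy
      exact hb _ _ _ _ (by simp) y hy
    | pop => simp
    | halt => simp
  | some (true, false, s, τ) =>
    simp only [tab]
    cases prog s with
    | pop i f =>
      simp only
      split_ifs
      · simp
      · apply hb; simp
    | _ => simp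
  | some (true, true, s, τ) =>
    simp only [tab]
    cases prog s with
    | pop i f => apply hb; simp
    | _ => simp

lemma outp_dum (ρ : ZMod q) (n : ℕ) : ∀ c, outp q (tab q prog dig dec) (List.replicate n (none, ρ)) c = [] := by
  induction n with
  | zero => intro c; rfl
  | succ n ih => intro c; simp [List.replicate_succ, outp, ih, tab]

lemma outp_blk (a : Al Q I) (ρ : ZMod q) (w : ℕ) (c : ZMod q) :
    outp q (tab q prog dig dec) (blk q a ρ w) c = ((tab q prog dig dec) a ρ).map (fun x => (x.1, x.2 + c)) := by
  simp [blk, outp, outp_dum]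

lemma newB_zero (s : Q) (τ : Option I) : (newB q prog s τ).map (fun x => (x.1, x.2 + 0)) = newB q prog s τ := by
  simp

/-- base `q` code of a stack -/
def encS : List Γ → ℕ
  | [] => 0
  | γ :: l => q * encS l + dig γ

def keep (i : I) : List (Option I) → ℕ → List (Option I)
  | [], _ => []
  | τ :: T, n => if τ = some i then (if (n : ZMod q) = -1 then [τ] else []) ++ keep i T (n + 1)
      else τ :: keep i T n

def P1 (s : Q) (i : I) : List (Option I) → ℕ → List (Al Q I × ZMod q)
  | [], _ => []
  | τ :: T, n => if τ = some i then blk q (some (true, false, s, τ)) n (q - 1) ++ P1 s i T (n + 1)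
      else blk q (some (true, false, s, τ)) n q ++ P1 s i T n

lemma keep_count_ne (i : I) (τ : Option I) (hτ : τ ≠ some i) (T : List (Option I)) : ∀ n,
    (keep q i T n).count τ = T.count τ := by
  induction T with
  | nil => intro n; rfl
  | cons a T ih =>
    intro n
    simp only [keep]
    split_ifs with h1 h2
    · subst h1; simp [ih, List.count_cons, hτ.symm]
    · subst h1; simp [ih, List.count_cons, hτ.symm]
    · simp [ih, List.count_cons]

lemma keep_count_eq (hq : 0 < q) (i : I) (T : List (Option I)) : ∀ n,
    (keep q i T n).count (some i) + n / q = (n + T.count (some i)) / q := by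
  induction T with
  | nil => intro n; simp [keep]
  | cons a T ih =>
    intro n
    have hd : (n : ZMod q) = -1 ↔ q ∣ n + 1 := by
      rw [← ZMod.natCast_eq_zero_iff, eq_neg_iff_add_eq_zero]; push_cast; rfl
    have hs := Nat.succ_div (a := n) (b := q)
    simp only [keep]
    split_ifs with h1 h2
    · rw [hd] at h2
      have := ih (n + 1)
      rw [hs, if_pos h2] at this
      subst h1
      simp only [List.singleton_append, List.count_cons_self]
      rw [show n + (T.count (some i) + 1) = n + 1 + T.count (some i) by ring, ← this]; ring
    · rw [hd] at h2
      have := ih (n + 1)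
      rw [hs, if_neg h2] at this
      subst h1
      simp only [List.nil_append, List.count_cons_self]
      rw [show n + (T.count (some i) + 1) = n + 1 + T.count (some i) by ring, ← this]; ring
    · rw [List.count_cons_of_ne h1, List.count_cons_of_ne h1, ih]

variable {q} {prog} in
lemma pop_pass1 (hq : 2 < q) {s : Q} {i : I} {f : Option Γ → Q} (hs : prog s = .pop i f) (T : List (Option I)) :
    ∀ n : ℕ, outp q (tab q prog dig dec) (T.flatMap (newB q prog s)) n = P1 q s i T n := by
  induction T with
  | nil => intro n; rfl
  | cons τ T ih =>
    intro n
    rw [List.flatMap_cons, outp_append, newB, outp_blk, blk_len _ _ _ _ (by simp [wid, hs]; split_ifs <;> omega)]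
    simp only [P1, tab, hs, blk_map, zero_add, wid]
    split_ifs with h
    · have := ih (n + 1)
      push_cast at this ⊢
      rw [this]
    · simp [ih n]

variable {q} {prog} in
lemma pop_len1 (hq : 2 < q) {s : Q} {i : I} {f : Option Γ → Q} (hs : prog s = .pop i f) (T : List (Option I)) :
    (((T.flatMap (newB q prog s)).length : ℕ) : ZMod q) = (T.count (some i) : ℕ) := by
  induction T with
  | nil => rfl
  | cons τ T ih =>
    rw [List.flatMap_cons, List.length_append, newB, blk_len _ _ _ _ (by simp [wid, hs]; split_ifs <;> omega)]
    push_cast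
    rw [ih]
    simp only [wid, hs]
    split_ifs with h
    · subst h; simp [add_comm]
    · simp [List.count_cons_of_ne h]

variable {q} in
lemma P1_len (hq : 2 < q) (s : Q) (i : I) (T : List (Option I)) : ∀ n,
    (((P1 q s i T n).length : ℕ) : ZMod q) = - (T.count (some i) : ℕ) := by
  induction T with
  | nil => intro n; simp [P1]
  | cons τ T ih =>
    intro n
    simp only [P1]
    split_ifs with h
    · subst h
      rw [List.length_append, blk_len _ _ _ _ (by omega)]
      push_cast
      rw [ih, Nat.cast_sub (by omega)]
      simp
    · rw [List.length_append, blk_len _ _ _ _ (by omega)]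
      push_cast
      rw [ih]
      simp [List.count_cons_of_ne h]

variable {q} {prog} in
lemma pop_pass2 (hq : 2 < q) {s : Q} {i : I} {f : Option Γ → Q} (hs : prog s = .pop i f) (T : List (Option I))
    (σ : ZMod q) : ∀ (n : ℕ) (c : ZMod q), (n : ZMod q) + c = σ →
    outp q (tab q prog dig dec) (P1 q s i T n) c = (keep q i T n).flatMap (fun τ => blk q (some (true, true, s, τ)) σ q) := by
  induction T with
  | nil => intro n c _; rfl
  | cons τ T ih =>
    intro n c hc
    simp only [P1, keep]
    split_ifs with h h2
    · rw [outp_append, outp_blk, blk_len _ _ _ _ (by omega), ih (n + 1)]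
      · simp [tab, hs, h, h2, blk_map, ← hc]
      · rw [Nat.cast_sub (by omega), ← hc]; push_cast; simp; ring
    · rw [outp_append, outp_blk, blk_len _ _ _ _ (by omega), ih (n + 1)]
      · simp [tab, hs, h, h2]
      · rw [Nat.cast_sub (by omega), ← hc]; push_cast; simp; ring
    · rw [outp_append, outp_blk, blk_len _ _ _ _ (by omega), ih n]
      · simp [tab, hs, h, blk_map, hc]
      · simpa using hc

/-- simulation relation -/
def trSU : Option (Q × (I → List Γ)) → List (Al Q I × ZMod q) × ZMod q → Prop
  | none, x => x = ([], 0)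
  | some (s, st), x => ∃ T : List (Option I), T.count none = 1 ∧
      (∀ i, T.count (some i) = encS q dig (st i)) ∧ x = (T.flatMap (newB q prog s), 0)

lemma gpush_count_none (i : I) (γ : Γ) (T : List (Option I)) :
    (T.flatMap (gpush q dig i γ)).count none = T.count none := by
  induction T with
  | nil => rfl
  | cons τ T ih =>
    rw [List.flatMap_cons, List.count_append, ih]
    match τ with
    | none => simp [gpush, List.count_replicate]; ring
    | some j => simp only [gpush]; split_ifs <;> simp [List.count_replicate]

lemma gpush_count_ne (i j : I) (hj : j ≠ i) (γ : Γ) (T : List (Option I)) :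
    (T.flatMap (gpush q dig i γ)).count (some j) = T.count (some j) := by
  induction T with
  | nil => rfl
  | cons τ T ih =>
    rw [List.flatMap_cons, List.count_append, ih]
    match τ with
    | none => simp [gpush, List.count_replicate, hj.symm]
    | some k =>
      simp only [gpush]
      split_ifs with h
      · subst h; simp [List.count_replicate, hj.symm]
      · simp [List.count_cons]; ring

lemma gpush_count_eq (i : I) (γ : Γ) (T : List (Option I)) :
    (T.flatMap (gpush q dig i γ)).count (some i) = q * T.count (some i) + dig γ * T.count none := by
  induction T with
  | nil => simp
  | cons τ T ih =>
    rw [List.flatMap_cons, List.count_append, ih]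
    match τ with
    | none => simp [gpush, List.count_replicate]; ring
    | some k =>
      simp only [gpush]
      split_ifs with h
      · subst h; simp [List.count_replicate]; ring
      · simp [List.count_cons, h]

theorem respects_SU (hq : 2 < q) (hdig : ∀ γ, dig γ < q) (hdec0 : dec 0 = none)
    (hdec : ∀ γ, dec (dig γ) = some γ) :
    Respects (sstep prog) (ustep q (tab q prog dig dec)) (trSU q prog dig) := by
  have hqq : ((q : ℕ) : ZMod q) = 0 := by simp
  intro a x h
  match a with
  | none =>
    have h : x = ([], 0) := h
    subst h
    rfl
  | some (s, st) =>
    obtain ⟨T, hT0, hTi, rfl⟩ := h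
    have hne : T.flatMap (newB q prog s) ≠ [] := by
      intro h
      rw [List.flatMap_eq_nil_iff] at h
      have : none ∈ T := by
        rw [← List.count_pos_iff]; omega
      simpa [newB, blk] using h none this
    have hp1 := pass1 q (tab q prog dig dec) _ 0 hne
    have hblkq : ∀ (b : Option I → Al Q I) (ρ : ZMod q) τ, (((blk q (b τ) ρ q).length : ℕ) : ZMod q) = 0 := by
      intro b ρ τ; rw [blk_len _ _ _ _ (by omega)]; exact hqq
    simp only [sstep]
    cases hs : prog s with
    | jump s' =>
      have hw : ∀ τ, (((newB q prog s τ).length : ℕ) : ZMod q) = 0 := by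
        intro τ; simp only [newB, wid, hs]; exact hblkq (fun τ => some (false, false, s, τ)) 0 τ
      refine ⟨(T.flatMap (newB q prog s'), 0), ⟨T, hT0, hTi, rfl⟩, ?_⟩
      rw [len_flatMap _ _ _ hw, outp_flatMap _ _ _ _ _ hw] at hp1
      have hp2 := pass q (tab q prog dig dec) (T.flatMap (fun τ => blk q (some (false, true, s, τ)) 0 q)) 0
      rw [len_flatMap _ _ _ (hblkq (fun τ => some (false, true, s, τ)) 0),
        outp_flatMap _ _ _ _ _ (hblkq (fun τ => some (false, true, s, τ)) 0)] at hp2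
      have e1 : ∀ τ, outp q (tab q prog dig dec) (newB q prog s τ) 0 = blk q (some (false, true, s, τ)) 0 q := by
        intro τ; simp [newB, outp_blk, tab, hs, blk_map]
      have e2 : ∀ τ, outp q (tab q prog dig dec) (blk q (some (false, true, s, τ)) 0 q) 0 = newB q prog s' τ := by
        intro τ; simp [outp_blk, tab, hs]
      simp only [e1, e2, add_zero] at hp1 hp2
      exact Relation.TransGen.trans_left hp1 hp2
    | push i γ s' =>
      have hw : ∀ τ, (((newB q prog s τ).length : ℕ) : ZMod q) = 0 := by
        intro τ; simp only [newB, wid, hs]; exact hblkq (fun τ => some (false, false, s, τ)) 0 τ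
      refine ⟨((T.flatMap (gpush q dig i γ)).flatMap (newB q prog s'), 0), ⟨_, ?_, ?_, rfl⟩, ?_⟩
      · rw [gpush_count_none]; exact hT0
      · intro j
        by_cases hj : j = i
        · subst hj
          rw [gpush_count_eq, Function.update_self, encS, hTi, hT0]; ring
        · rw [gpush_count_ne _ _ _ _ hj, Function.update_of_ne hj, hTi]
      rw [len_flatMap _ _ _ hw, outp_flatMap _ _ _ _ _ hw] at hp1
      have hp2 := pass q (tab q prog dig dec) (T.flatMap (fun τ => blk q (some (false, true, s, τ)) 0 q)) 0
      rw [len_flatMap _ _ _ (hblkq (fun τ => some (false, true, s, τ)) 0),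
        outp_flatMap _ _ _ _ _ (hblkq (fun τ => some (false, true, s, τ)) 0)] at hp2
      have e1 : ∀ τ, outp q (tab q prog dig dec) (newB q prog s τ) 0 = blk q (some (false, true, s, τ)) 0 q := by
        intro τ; simp [newB, outp_blk, tab, hs, blk_map]
      have e2 : ∀ τ, outp q (tab q prog dig dec) (blk q (some (false, true, s, τ)) 0 q) 0 = (gpush q dig i γ τ).flatMap (newB q prog s') := by
        intro τ; simp [outp_blk, tab, hs]
      simp only [e1, e2, add_zero] at hp1 hp2
      rw [List.flatMap_assoc]
      exact Relation.TransGen.trans_left hp1 hp2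
    | halt =>
      have hw : ∀ τ, (((newB q prog s τ).length : ℕ) : ZMod q) = 0 := by
        intro τ; simp only [newB, wid, hs]; exact hblkq (fun τ => some (false, false, s, τ)) 0 τ
      refine ⟨([], 0), rfl, ?_⟩
      rw [len_flatMap _ _ _ hw, outp_flatMap _ _ _ _ _ hw] at hp1
      have e : T.flatMap (fun τ => outp q (tab q prog dig dec) (newB q prog s τ) 0) = [] := by
        simp [newB, outp_blk, tab, hs]
      rw [e] at hp1
      simpa using hp1
    | pop i f =>
      have h0 : ((0 : ℕ) : ZMod q) = 0 := Nat.cast_zero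
      rw [pop_len1 hq hs] at hp1
      have e1 := pop_pass1 dig dec hq hs T 0
      rw [h0] at e1
      rw [e1, zero_add] at hp1
      set σ : ZMod q := ((T.count (some i) : ℕ) : ZMod q) with hσ
      have hp2 := pass q (tab q prog dig dec) (P1 q s i T 0) σ
      rw [P1_len hq, ← hσ, add_neg_cancel, pop_pass2 dig dec hq hs T σ 0 σ (by simp)] at hp2
      have hp3 := pass q (tab q prog dig dec) ((keep q i T 0).flatMap (fun τ => blk q (some (true, true, s, τ)) σ q)) 0
      rw [len_flatMap _ _ _ (hblkq (fun τ => some (true, true, s, τ)) σ),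
        outp_flatMap _ _ _ _ _ (hblkq (fun τ => some (true, true, s, τ)) σ)] at hp3
      have hhead : dec σ = (st i).head? := by
        rw [hσ, hTi]
        cases st i with
        | nil => simpa [encS] using hdec0
        | cons γ l => simp [encS, hdec]
      refine ⟨((keep q i T 0).flatMap (newB q prog (f (st i).head?)), 0), ⟨_, ?_, ?_, rfl⟩, ?_⟩
      · rw [keep_count_ne _ _ _ (by simp)]; exact hT0
      · intro j
        by_cases hj : j = i
        · subst hj
          have := keep_count_eq q (by omega) j T 0
          rw [Nat.zero_div, add_zero, zero_add, hTi] at this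
          rw [this, Function.update_self]
          cases st j with
          | nil => simp [encS]
          | cons γ l =>
            simp only [encS, List.tail_cons]
            rw [Nat.mul_add_div (by omega), Nat.div_eq_of_lt (hdig γ), add_zero]
        · rw [keep_count_ne _ _ _ (by simpa using hj), Function.update_of_ne hj, hTi]
      · refine Relation.TransGen.trans_left (Relation.TransGen.trans_left hp1 hp2) ?_
        have e3 : ∀ τ, outp q (tab q prog dig dec) (blk q (some (true, true, s, τ)) σ q) 0 = newB q prog (f (st i).head?) τ := by
          intro τ; simp [outp_blk, tab, hs, hhead]
        simp only [e3, add_zero] at hp3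
        exact hp3

end PartG
end WP


namespace WP

/-! ### Part H : multi-stack Turing machines as stack machines -/

section PartH
open StateTransition Turing

variable {K Γ Λ σ : Type} [DecidableEq K]

section
variable (M : Λ → TM2.Stmt (fun _ : K => Γ) Λ σ) (Sup : Finset Λ)

def OkS (s : TM2.Stmt (fun _ : K => Γ) Λ σ) : Prop := ∃ l ∈ Sup, s ∈ TM2.stmts₁ (M l)

abbrev QT : Type := Option (Option (K × Γ) × {s // OkS M Sup s} × σ)

lemma OkS_finite : Finite {s // OkS M Sup s} := by
  classical
  have : {s | OkS M Sup s} = ((Sup.biUnion (fun l => TM2.stmts₁ (M l)) : Finset _) : Set _) := by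
    ext s; simp [OkS]
  exact Set.Finite.to_subtype (s := {s | OkS M Sup s}) (this ▸ Finset.finite_toSet _)

open Classical in
noncomputable def mkQ (b : Option (K × Γ)) (s : TM2.Stmt (fun _ : K => Γ) Λ σ) (v : σ) : QT M Sup :=
  if h : OkS M Sup s then some (b, ⟨s, h⟩, v) else none

noncomputable def progT : QT M Sup → Ins (QT M Sup) K Γ
  | none => .halt
  | some (some (k, γ), s, v) => .push k γ (mkQ M Sup none s.1 v)
  | some (none, s, v) =>
    match s.1 with
    | .push k f s' => .push k (f v) (mkQ M Sup none s' v)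
    | .peek k f s' => .pop k (fun o => mkQ M Sup (o.map (fun γ => (k, γ))) s' (f v o))
    | .pop k f s' => .pop k (fun o => mkQ M Sup none s' (f v o))
    | .load a s' => .jump (mkQ M Sup none s' (a v))
    | .branch f s₁ s₂ => .jump (if f v then mkQ M Sup none s₁ v else mkQ M Sup none s₂ v)
    | .goto l => .jump (mkQ M Sup none (M (l v)) v)
    | .halt => .jump none

def trTS : TM2.Cfg (fun _ : K => Γ) Λ σ → Option (QT M Sup × (K → List Γ)) → Prop
  | ⟨some l, v, S⟩, x => l ∈ Sup ∧ x = some (mkQ M Sup none (M l) v, S)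
  | ⟨none, _, _⟩, x => x = none

lemma OkS_self {l : Λ} (hl : l ∈ Sup) : OkS M Sup (M l) := ⟨l, hl, TM2.stmts₁_self⟩

variable {M Sup}
lemma OkS_trans {s s' : TM2.Stmt (fun _ : K => Γ) Λ σ} (h : OkS M Sup s) (h' : s' ∈ TM2.stmts₁ s) : OkS M Sup s' := by
  obtain ⟨l, hl, hs⟩ := h
  exact ⟨l, hl, TM2.stmts₁_trans hs h'⟩

lemma mkQ_ok {b : Option (K × Γ)} {s : TM2.Stmt (fun _ : K => Γ) Λ σ} (h : OkS M Sup s) (v : σ) :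
    mkQ M Sup b s v = some (b, ⟨s, h⟩, v) := by simp [mkQ, h]

lemma stepAux_sim (hsup : ∀ l ∈ Sup, TM2.SupportsStmt Sup (M l)) (s : TM2.Stmt (fun _ : K => Γ) Λ σ) :
    OkS M Sup s → ∀ v S, ∃ b, trTS M Sup (TM2.stepAux s v S) b ∧
      Reaches₁ (sstep (progT M Sup)) (some (mkQ M Sup none s v, S)) b := by
  have one : ∀ {x y}, sstep (progT M Sup) x = some y → Reaches (sstep (progT M Sup)) x y :=
    fun h => Relation.ReflTransGen.single h
  induction s with
  | push k f s ih =>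
    intro hs v S
    have hs' : OkS M Sup s := OkS_trans hs (by simp [TM2.stmts₁, TM2.stmts₁_self])
    obtain ⟨b, hb, hr⟩ := ih hs' v (Function.update S k (f v :: S k))
    refine ⟨b, hb, Relation.TransGen.head ?_ hr⟩
    rw [mkQ_ok hs]
    simp [sstep, progT]
  | peek k f s ih =>
    intro hs v S
    have hs' : OkS M Sup s := OkS_trans hs (by simp [TM2.stmts₁, TM2.stmts₁_self])
    obtain ⟨b, hb, hr⟩ := ih hs' (f v (S k).head?) S
    refine ⟨b, hb, ?_⟩
    rw [mkQ_ok hs]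
    cases hS : S k with
    | nil =>
      refine Relation.TransGen.head ?_ hr
      simp only [sstep, progT, hS, Option.mem_def, List.head?_nil, Option.map_none, List.tail_nil]
      rw [← hS, Function.update_eq_self]
    | cons γ l =>
      refine Relation.TransGen.head (b := some (mkQ M Sup (some (k, γ)) s (f v (some γ)), Function.update S k l)) ?_
        (Relation.TransGen.head ?_ hr)
      · simp [sstep, progT, hS]
      · rw [mkQ_ok hs']
        simp only [sstep, progT, hS, Option.mem_def, List.head?_cons, Function.update_self, Function.update_idem]
        rw [← hS, Function.update_eq_self]
  | pop k f s ih =>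
    intro hs v S
    have hs' : OkS M Sup s := OkS_trans hs (by simp [TM2.stmts₁, TM2.stmts₁_self])
    obtain ⟨b, hb, hr⟩ := ih hs' (f v (S k).head?) (Function.update S k (S k).tail)
    refine ⟨b, hb, Relation.TransGen.head ?_ hr⟩
    rw [mkQ_ok hs]
    simp [sstep, progT]
  | load a s ih =>
    intro hs v S
    have hs' : OkS M Sup s := OkS_trans hs (by simp [TM2.stmts₁, TM2.stmts₁_self])
    obtain ⟨b, hb, hr⟩ := ih hs' (a v) S
    refine ⟨b, hb, Relation.TransGen.head ?_ hr⟩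
    rw [mkQ_ok hs]
    simp [sstep, progT]
  | branch f s₁ s₂ ih₁ ih₂ =>
    intro hs v S
    have h₁ : OkS M Sup s₁ := OkS_trans hs (by simp [TM2.stmts₁, TM2.stmts₁_self])
    have h₂ : OkS M Sup s₂ := OkS_trans hs (by simp [TM2.stmts₁, TM2.stmts₁_self])
    cases hf : f v
    · obtain ⟨b, hb, hr⟩ := ih₂ h₂ v S
      refine ⟨b, by simpa [hf] using hb, Relation.TransGen.head ?_ hr⟩
      rw [mkQ_ok hs]
      simp [sstep, progT, hf]
    · obtain ⟨b, hb, hr⟩ := ih₁ h₁ v S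
      refine ⟨b, by simpa [hf] using hb, Relation.TransGen.head ?_ hr⟩
      rw [mkQ_ok hs]
      simp [sstep, progT, hf]
  | goto l =>
    intro hs v S
    have hl : l v ∈ Sup := by
      obtain ⟨l', hl', hm⟩ := hs
      exact TM2.stmts₁_supportsStmt_mono hm (hsup l' hl') v
    refine ⟨_, ⟨hl, rfl⟩, Relation.TransGen.single ?_⟩
    rw [mkQ_ok hs]
    simp [sstep, progT]
  | halt =>
    intro hs v S
    refine ⟨none, rfl, ?_⟩
    rw [mkQ_ok hs]
    refine Relation.TransGen.head (b := some (none, S)) ?_ (Relation.TransGen.single ?_)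
    · simp [sstep, progT]
    · simp [sstep, progT]

theorem respects_TS (hsup : ∀ l ∈ Sup, TM2.SupportsStmt Sup (M l)) :
    Respects (TM2.step M) (sstep (progT M Sup)) (trTS M Sup) := by
  rintro ⟨_ | l, v, S⟩ x h
  · have h : x = none := h
    subst h
    rfl
  · obtain ⟨hl, rfl⟩ := h
    exact stepAux_sim hsup (M l) (OkS_self M Sup hl) v S

end

open PartrecToTM2 in
theorem K'_finite : Finite K' :=
  Finite.of_injective (fun k : K' => (match k with | .main => (0 : Fin 4) | .rev => 1 | .aux => 2 | .stack => 3))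
    (by intro a b; cases a <;> cases b <;> simp)

open PartrecToTM2 in
/-- A universal stack machine. -/
theorem exists_SM (f : ℕ →. ℕ) (hf : Nat.Partrec f) :
    ∃ (Q : Type) (_ : Finite Q) (prog : Q → Ins Q K' Γ') (s₀ : Q), ∀ n : ℕ,
      (f n).Dom ↔ (eval (sstep prog) (some (s₀, K'.elim (trList [n]) [] [] []))).Dom := by
  have hf' : Nat.Partrec' (fun v : List.Vector ℕ 1 => f v.head) :=
    Nat.Partrec'.part_iff₁.2 (Partrec.nat_iff.2 hf)
  obtain ⟨c, hc⟩ := ToPartrec.Code.exists_code hf'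
  have hsup := (tr_supports c Cont'.halt)
  let Sup := codeSupp c Cont'.halt
  have hfinK : Finite K' := K'_finite
  have := OkS_finite (K := K') (Γ := Γ') (σ := Option Γ') tr Sup
  refine ⟨QT (K := K') (Γ := Γ') (σ := Option Γ') tr Sup, inferInstance, progT tr Sup,
    mkQ tr Sup none (tr (trNormal c Cont'.halt)) none, fun n => ?_⟩
  rw [tr_eval_dom (respects_TS (K := K') (Γ := Γ') (σ := Option Γ') (M := tr) (Sup := Sup) hsup.2)
    (a₁ := init c [n]) (a₂ := some (mkQ tr Sup none (tr (trNormal c Cont'.halt)) none, K'.elim (trList [n]) [] [] []))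
    ⟨hsup.1, rfl⟩]
  rw [PartrecToTM2.tr_eval]
  have := hc ⟨[n], rfl⟩
  simp only at this
  rw [this]
  simp
  rfl

end PartH
end WP

namespace WP
section PartI
open Turing

/-- numeric code of the machine input -/
def inE (q d0 d1 dc : ℕ) (n : ℕ) : ℕ :=
  if _h : n = 0 then dc else
    q * inE q d0 d1 dc (n / 2) + (if n % 2 = 1 then d1 else d0)
  decreasing_by omega

theorem inE_primrec (q d0 d1 dc : ℕ) : Primrec (inE q d0 d1 dc) := by
  have key : Primrec₂ (fun (_ : Unit) n => inE q d0 d1 dc n) := by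
    refine Primrec.nat_strong_rec (fun (_ : Unit) n => inE q d0 d1 dc n)
      (g := fun _ l => if l.length = 0 then some dc else
        (l[l.length / 2]?).map (fun e => q * e + (if l.length % 2 = 1 then d1 else d0))) ?_ ?_
    · have hlen : Primrec (fun p : Unit × List ℕ => p.2.length) :=
        Primrec.list_length.comp Primrec.snd
      have hlen2 : Primrec (fun p : (Unit × List ℕ) × ℕ => p.1.2.length) :=
        hlen.comp Primrec.fst
      refine Primrec.ite (Primrec.eq.comp hlen (Primrec.const 0)) (Primrec.const _) ?_
      refine Primrec.option_map (Primrec.list_getElem?.comp Primrec.snd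
        (Primrec.nat_div.comp hlen (Primrec.const 2))) ?_
      refine Primrec.nat_add.comp (Primrec.nat_mul.comp (Primrec.const q) Primrec.snd) ?_
      exact Primrec.ite (Primrec.eq.comp (Primrec.nat_mod.comp hlen2 (Primrec.const 2))
        (Primrec.const 1)) (Primrec.const _) (Primrec.const _)
    · intro _ n
      by_cases h : n = 0
      · subst h; rw [inE]; simp
      · have h2 : n / 2 < n := by omega
        rw [inE]
        simp [h, h2]
  exact key.comp (Primrec.const ()) Primrec.id

open PartrecToTM2 in
theorem encS_trPosNum (q : ℕ) (dig : Γ' → ℕ) (p : PosNum) :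
    encS q dig (trPosNum p ++ [Γ'.cons]) =
      inE q (dig Γ'.bit0) (dig Γ'.bit1) (q * 0 + dig Γ'.cons) (p : ℕ) := by
  induction p with
  | one => 
    rw [inE]; simp [trPosNum, encS]
    rw [inE]; simp
  | bit1 p ih =>
    rw [inE]
    have : ((p.bit1 : PosNum) : ℕ) = 2 * (p : ℕ) + 1 := by simp [PosNum.cast_bit1]; ring
    rw [this]
    have h1 : (2 * (p : ℕ) + 1) / 2 = p := by omega
    rw [h1, ← ih]
    simp [trPosNum, encS, Nat.add_mod]
  | bit0 p ih =>
    have hp : (0 : ℕ) < p := PosNum.to_nat_pos p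
    rw [inE]
    have : ((p.bit0 : PosNum) : ℕ) = 2 * (p : ℕ) := by simp [PosNum.cast_bit0]; ring
    rw [this]
    have h1 : (2 * (p : ℕ)) / 2 = p := by omega
    have h2 : ¬ (2 * (p : ℕ) = 0) := by omega
    rw [h1, ← ih]
    simp [trPosNum, encS, hp.ne']

open PartrecToTM2 in
theorem encS_trList (q : ℕ) (dig : Γ' → ℕ) (n : ℕ) :
    encS q dig (trList [n]) =
      inE q (dig Γ'.bit0) (dig Γ'.bit1) (q * 0 + dig Γ'.cons) n := by
  have h : ((n : Num) : ℕ) = n := Num.to_of_nat n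
  have e : trList [n] = trNum (n : Num) ++ [Γ'.cons] := rfl
  rw [e]
  generalize (n : Num) = m at h
  subst h
  cases m with
  | zero => show encS q dig [Γ'.cons] = _ ; rw [inE]; simp [encS]
  | pos p => exact encS_trPosNum q dig p

/-- list spelling of a power -/
def repL {α : Type*} (b : List α) (N : ℕ) : List α := Nat.rec [] (fun _ l => b ++ l) N

theorem repL_primrec {α : Type*} [Primcodable α] (b : List α) : Primrec (repL b) := by
  have : Primrec₂ (fun (_ : Unit) (N : ℕ) => repL b N) :=
    Primrec.nat_rec (f := fun (_ : Unit) => ([] : List α))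
      (g := fun (_ : Unit) (p : ℕ × List α) => b ++ p.2) (Primrec.const _)
      (Primrec.list_append.comp (Primrec.const b) (Primrec.snd.comp Primrec.snd))
  exact this.comp (Primrec.const ()) Primrec.id

theorem mk_repL {α : Type*} (b : List (α × Bool)) (N : ℕ) :
    FreeGroup.mk (repL b N) = FreeGroup.mk b ^ N := by
  induction N with
  | zero => rfl
  | succ N ih => rw [pow_succ', ← ih, FreeGroup.mul_mk]; rfl

/-- Words for test elements are computable. -/
theorem testword (C0 C1 z t : FreeGroup (Fin 5)) : ∃ F : ℕ → List (Fin 5 × Bool), Primrec F ∧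
    ∀ N, FreeGroup.mk (F N) = testG z t (C0 * C1 ^ N) := by
  have app : ∀ F G : ℕ → List (Fin 5 × Bool), Primrec F → Primrec G →
    Primrec (fun N => F N ++ G N) := fun F G hF hG => Primrec.list_append.comp hF hG
  let R := fun h : FreeGroup (Fin 5) => repL h.toWord
  have hR : ∀ h, Primrec (R h) := fun h => repL_primrec _
  refine ⟨fun N => ((((((t * C0).toWord ++ R C1 N) ++ z.toWord) ++ R C1⁻¹ N) ++ (C0⁻¹ * t⁻¹ * C0).toWord)
    ++ R C1 N) ++ ((z^2)⁻¹.toWord ++ R C1⁻¹ N) ++ C0⁻¹.toWord, ?_, ?_⟩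
  · have k : ∀ h : FreeGroup (Fin 5), Primrec (fun _ : ℕ => h.toWord) := fun h => Primrec.const _
    exact app _ _ (app _ _ (app _ _ (app _ _ (app _ _ (app _ _ (app _ _ (k _) (hR _)) (k _)) (hR _)) (k _))
      (hR _)) (app _ _ (k _) (hR _))) (k _)
  · intro N
    simp only [← FreeGroup.mul_mk, FreeGroup.mk_toWord, R, mk_repL, testG]
    group

theorem cfgG_append {G : Type*} [Group G] (p x : G) (v w : List Bool) :
    cfgG p x (v ++ w) = cfgG p x v * cfgG p x w := by
  simp [cfgG]

theorem cfgG_rep {G : Type*} [Group G] (p x : G) (v w : List Bool) (N : ℕ) :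
    cfgG p x (v ++ (List.replicate N w).flatten) = cfgG p x v * cfgG p x w ^ N := by
  rw [cfgG_append]
  congr 1
  induction N with
  | zero => simp [cfgG]
  | succ N ih => rw [List.replicate_succ, List.flatten_cons, cfgG_append, ih, pow_succ']

/-- arithmetic of the ring of integers mod `q ^ 2` -/
theorem arith (q : ℕ) (hp : q.Prime) (h2 : q ≠ 2) : ∃ u : (ZMod (q^2))ˣ, ∀ n : ZMod (q^2), n ≠ 0 →
    ∃ k : ℕ, n = (u:ZMod (q^2))^k ∨ n = (q:ZMod (q^2)) * (u:ZMod (q^2))^k := by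
  have : NeZero (q^2) := ⟨pow_ne_zero _ hp.ne_zero⟩
  obtain ⟨u, hu⟩ := (ZMod.isCyclic_units_of_prime_pow q hp h2 2).exists_generator
  have hpow : ∀ m : ℕ, m.Coprime q → ∃ k : ℕ, (m : ZMod (q^2)) = (u:ZMod (q^2))^k := by
    intro m hm
    obtain ⟨k, hk⟩ := (Submonoid.mem_powers_iff _ _).1
      ((mem_powers_iff_mem_zpowers (x := u)).2 (hu (ZMod.unitOfCoprime m (hm.pow_right 2))))
    refine ⟨k, ?_⟩
    rw [← Units.val_pow_eq_pow_val, hk, ZMod.coe_unitOfCoprime]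
  refine ⟨u, fun n hn => ?_⟩
  have hv : ((n.val : ℕ) : ZMod (q^2)) = n := ZMod.natCast_zmod_val n
  by_cases hc : n.val.Coprime q
  · obtain ⟨k, hk⟩ := hpow _ hc
    exact ⟨k, Or.inl (by rw [← hk, hv])⟩
  · have hd : q ∣ n.val := by
      by_contra hd
      exact hc ((hp.coprime_iff_not_dvd.2 hd).symm)
    obtain ⟨m, hm⟩ := hd
    have hmc : m.Coprime q := by
      refine ((hp.coprime_iff_not_dvd.2 ?_).symm)
      rintro ⟨j, rfl⟩
      apply hn
      rw [← hv, hm, ZMod.natCast_eq_zero_iff]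
      exact ⟨j, by ring⟩
    obtain ⟨k, hk⟩ := hpow _ hmc
    exact ⟨k, Or.inr (by rw [← hk, ← hv, hm]; push_cast; rfl)⟩

/-- an undecidable domain -/
theorem exists_undec : ∃ f : ℕ →. ℕ, Nat.Partrec f ∧ ¬ ComputablePred (fun n => (f n).Dom) := by
  refine ⟨fun n => Nat.Partrec.Code.eval (Denumerable.ofNat Nat.Partrec.Code n) 0, ?_, ?_⟩
  · apply Partrec.nat_iff.1
    exact Nat.Partrec.Code.eval_part.comp (Computable.ofNat _) (Computable.const 0)
  · intro h
    apply ComputablePred.halting_problem 0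
    have := ComputablePred.of_eq (p := fun c : Nat.Partrec.Code => 
      (Nat.Partrec.Code.eval (Denumerable.ofNat Nat.Partrec.Code (Encodable.encode c)) 0).Dom)
      (q := fun c : Nat.Partrec.Code => (Nat.Partrec.Code.eval c 0).Dom) ?_ (fun c => by simp)
    · exact this
    · obtain ⟨g, hg, e⟩ := ComputablePred.computable_iff.1 h
      refine ComputablePred.computable_iff.2 ⟨fun c => g (Encodable.encode c), hg.comp Computable.encode, ?_⟩
      funext c
      exact congrFun e (Encodable.encode c)
end PartI
end WP

namespace WP
section PartJ
open Turing StateTransition PartrecToTM2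

theorem group_halting (Q : Type) (hQ : Finite Q) (prog : Q → Ins Q K' Γ') (s₀ : Q) :
    ∃ (q g : ℕ) (o : List ℕ) (F : ℕ → List (Fin 5 × Bool)), Computable F ∧
    let rels : Fin 12 → FreeGroup (Fin 5) := relG q g o (.of 0) (.of 1) (.of 2) (.of 3) (.of 4)
    ∀ n : ℕ, PresentedGroup.mk (Set.range rels) (FreeGroup.mk (F n)) = 1 ↔
      (eval (sstep prog) (some (s₀, K'.elim (trList [n]) [] [] []))).Dom := by
  classical
  have hK : Finite K' := K'_finite
  have hA : Finite (Al Q K') := by unfold Al; infer_instance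
  let _ : Fintype (Al Q K') := Fintype.ofFinite _
  let enc : Al Q K' → ℕ := fun a => (Fintype.equivFin _ a : ℕ)
  have hinj : Function.Injective enc := fun a b h => (Fintype.equivFin _).injective (Fin.ext h)
  let dig : Γ' → ℕ := fun γ => match γ with | .consₗ => 1 | .cons => 2 | .bit0 => 3 | .bit1 => 4
  have dinj : Function.Injective dig := by
    intro a b; cases a <;> cases b <;> simp [dig]
  have dpos : ∀ γ, 0 < dig γ := by intro γ; cases γ <;> simp [dig]
  have d5 : ∀ γ, dig γ < 5 := by intro γ; cases γ <;> simp [dig]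
  obtain ⟨q, hqN, hp⟩ := Nat.exists_infinite_primes (Fintype.card (Al Q K') + 7)
  have hq2 : 2 < q := by omega
  have hlt : ∀ a, enc a + 2 < q := by
    intro a
    have : enc a < Fintype.card (Al Q K') := (Fintype.equivFin _ a).2
    omega
  have hdig : ∀ γ, dig γ < q := fun γ => by have := d5 γ; omega
  have : NeZero q := ⟨hp.ne_zero⟩
  have : NeZero (q^2) := ⟨pow_ne_zero _ hp.ne_zero⟩
  let dec : ZMod q → Option Γ' := fun r => 
    if h : ∃ γ, ((dig γ : ℕ) : ZMod q) = r then some h.choose else none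
  have cast_inj : ∀ a b : ℕ, a < q → b < q → ((a : ℕ) : ZMod q) = ((b : ℕ) : ZMod q) → a = b := by
    intro a b ha hb h
    have := (ZMod.natCast_eq_natCast_iff' a b q).1 h
    rwa [Nat.mod_eq_of_lt ha, Nat.mod_eq_of_lt hb] at this
  have hdec0 : dec 0 = none := by
    refine dif_neg ?_
    rintro ⟨γ, h⟩
    have := cast_inj (dig γ) 0 (hdig γ) (by omega) (by simpa using h)
    have := dpos γ
    omega
  have hdec : ∀ γ, dec (dig γ) = some γ := by
    intro γ
    have h : ∃ γ', ((dig γ' : ℕ) : ZMod q) = ((dig γ : ℕ) : ZMod q) := ⟨γ, rfl⟩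
    have e : dec (dig γ) = some h.choose := dif_pos h
    rw [e]
    congr 1
    exact dinj (cast_inj _ _ (hdig _) (hdig _) h.choose_spec)
  obtain ⟨u, harith⟩ := arith q hp (by omega)
  let g : ℕ := (u : ZMod (q^2)).val
  have hg : ((g : ℕ) : ZMod (q^2)) = u := ZMod.natCast_zmod_val _
  have hq1 : 1 < q ^ 2 := Nat.one_lt_pow (by omega) (by omega)
  have : Fact (1 < q^2) := ⟨hq1⟩
  have hnt : (1 : ZMod (q^2)) ≠ 0 := one_ne_zero
  have : NeZero g := ⟨fun h => by
    have hu : IsUnit (u : ZMod (q^2)) := u.isUnit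
    rw [← hg, h, Nat.cast_zero] at hu
    exact not_isUnit_zero hu⟩
  have hqne : (q : ZMod (q^2)) ≠ 0 := by
    rw [Ne, ZMod.natCast_eq_zero_iff]
    intro h
    have := Nat.le_of_dvd (by omega) h
    nlinarith
  let Tab := tab q prog dig dec
  let o := oList q enc Tab
  let z : FreeGroup (Fin 5) := .of 0
  let p : FreeGroup (Fin 5) := .of 1
  let x : FreeGroup (Fin 5) := .of 2
  let ω : FreeGroup (Fin 5) := .of 3
  let t : FreeGroup (Fin 5) := .of 4
  let W : Option K' → List Bool := fun τ => (newB q prog s₀ τ).flatMap (pblk q enc)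
  let T : ℕ → List (Option K') := fun N => none :: List.replicate N (some K'.main)
  let P : ℕ → List (Al Q K' × ZMod q) := fun N => (T N).flatMap (newB q prog s₀)
  let w : ℕ → List Bool := fun N => (P N).flatMap (pblk q enc)
  have hw : ∀ N, cfgG p x (w N) = cfgG p x (W none) * cfgG p x (W (some K'.main)) ^ N := by
    intro N
    rw [← cfgG_rep]
    congr 1
    simp only [w, P, T, W, List.flatMap_cons, List.flatMap_append, List.flatMap_assoc]
    congr 1
    simp [List.flatMap, List.map_replicate]
  obtain ⟨F, hF, hFt⟩ := testword (cfgG p x (W none)) (cfgG p x (W (some K'.main))) z t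
  let E : ℕ → ℕ := inE q (dig Γ'.bit0) (dig Γ'.bit1) (q * 0 + dig Γ'.cons)
  refine ⟨q, g, o.map ZMod.val, fun n => F (E n), (hF.comp (inE_primrec _ _ _ _)).to_comp, ?_⟩
  intro rels n
  have hinit : trSU q prog dig (some (s₀, K'.elim (trList [n]) [] [] [])) (P (E n), 0) := by
    refine ⟨T (E n), ?_, ?_, rfl⟩
    · simp [T, List.count_replicate]
    · intro i
      cases i with
      | main =>
        show _ = encS q dig (trList [n])
        rw [encS_trList]
        simp [T, E]
      | rev => simp [T, List.count_replicate, K'.elim, encS]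
      | aux => simp [T, List.count_replicate, K'.elim, encS]
      | stack => simp [T, List.count_replicate, K'.elim, encS]
  have hresp := respects_SU q prog dig dec hq2 hdig hdec0 hdec
  have hFn : FreeGroup.mk (F (E n)) = testG z t (cfgG p x (w (E n))) := by rw [hFt, hw]
  rw [← tr_eval_dom hresp hinit]
  show PresentedGroup.mk (Set.range rels) (FreeGroup.mk (F (E n))) = 1 ↔ _
  rw [hFn]
  constructor
  · intro h
    obtain ⟨z', p', x', ω', t', hrel, hmodel⟩ := model q u g hg hqne o
    let φ : FreeGroup (Fin 5) →* _ := FreeGroup.lift ![z', p', x', ω', t']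
    have hker : ∀ r ∈ Set.range rels, φ r = 1 := by
      rintro _ ⟨i, rfl⟩
      have := map_relG φ q g (o.map ZMod.val) z p x ω t i
      refine this.trans ?_
      simpa [φ, z, p, x, ω, t] using hrel i
    have h1 : φ (testG z t (cfgG p x (w (E n)))) = 1 := by
      have h2 := congrArg (PresentedGroup.toGroup (f := ![z', p', x', ω', t']) hker) h
      rw [map_one] at h2
      exact h2
    have h3 : testG z' t' (cfgG p' x' (w (E n))) = 1 := by
      rw [← h1]
      rw [map_testG, map_cfgG]
      simp [φ, z, p, x, t]
    have horb := hmodel _ h3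
    have hV := vto_of_OrbP o (pq q) (oList_len_q q Tab)
      (oList_good q Tab hq2 hlt hinj (tab_child q prog dig dec)) (w (E n)) 0
      (by rw [pblk_len]; simp) horb
    exact eval_of_UTo q Tab _ _ _ (U_of_V_init q Tab hq2 hlt hinj _ hV)
  · intro h
    have h' := (tr_eval_dom hresp hinit).1 h
    obtain ⟨b, hb⟩ := Part.dom_iff_mem.1 h'
    obtain ⟨b₂, hb₂, hb₂e⟩ := tr_eval hresp hinit hb
    have hbn : b = none := by
      have := (mem_eval.1 hb).2
      cases b with
      | none => rfl
      | some b => cases this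
    subst hbn
    have e : b₂ = ([], 0) := hb₂
    subst e
    have hU := UTo_of_eval q Tab (fun c => c = 0) _ _ hb₂e rfl
    have hV := V_init_of_U q Tab hq2 hlt hinj _ hU
    let ψ := PresentedGroup.mk (Set.range rels)
    have hr : ∀ i, relG q g (o.map ZMod.val) (ψ z) (ψ p) (ψ x) (ψ ω) (ψ t) i = 1 := by
      intro i
      have h1 := map_relG ψ q g (o.map ZMod.val) z p x ω t i
      have h2 : ψ (rels i) = 1 := PresentedGroup.one_of_mem (rels := Set.range rels) ⟨i, rfl⟩
      exact h1.symm.trans h2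
    have := complete q g u hg hnt harith o (ψ z) (ψ p) (ψ x) (ψ ω) (ψ t) hr (w (E n)) hV
    show ψ _ = 1
    rw [map_testG, map_cfgG]
    exact this
end PartJ
end WP

theorem exists_twelve_relator_presentation_with_unsolvable_word_problem :
    ∃ rels : Fin 12 → FreeGroup (Fin 5),
      (¬ ComputablePred fun l : List (Fin 5 × Bool) =>
        PresentedGroup.mk (Set.range rels) (FreeGroup.mk l) = 1) ∧
      orderOf (Abelianization.of
        (PresentedGroup.of (rels := Set.range rels) (0 : Fin 5))) ∣ 3 ∧
      orderOf (Abelianization.of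
        (PresentedGroup.of (rels := Set.range rels) (1 : Fin 5))) ∣ 4 ∧
      ∃ (p : ℕ) (hp : p ≤ 5), 1 ≤ p ∧ ∃ q : Fin p → ℕ,
        (∀ i, 1 ≤ q i) ∧
        (∀ i, orderOf (Abelianization.of
          (PresentedGroup.of (rels := Set.range rels) (Fin.castLE hp i))) = q i) ∧
        Finset.univ.gcd q = 1 := by
  obtain ⟨f, hf, hund⟩ := WP.exists_undec
  obtain ⟨Q, hQ, prog, s₀, hsm⟩ := WP.exists_SM f hf
  obtain ⟨q, g, o, F, hF, hmain⟩ := WP.group_halting Q hQ prog s₀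
  let rels : Fin 12 → FreeGroup (Fin 5) := WP.relG q g o (.of 0) (.of 1) (.of 2) (.of 3) (.of 4)
  have h0 : Abelianization.of (PresentedGroup.of (rels := Set.range rels) (0 : Fin 5)) = 1 := by
    have h1 : PresentedGroup.mk (Set.range rels) (rels 11) = 1 :=
      PresentedGroup.one_of_mem (rels := Set.range rels) ⟨11, rfl⟩
    have h2 : rels 11 = .of 4 * .of 0 * (.of 4)⁻¹ * ((.of 0)^2)⁻¹ := rfl
    rw [h2] at h1
    have h3 := congrArg Abelianization.of h1
    simp only [map_mul, map_inv, map_pow, map_one] at h3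
    change _ = _ at h3
    set a := Abelianization.of (PresentedGroup.of (rels := Set.range rels) (0 : Fin 5)) with ha
    set b := Abelianization.of (PresentedGroup.of (rels := Set.range rels) (4 : Fin 5)) with hb
    change b * a * b⁻¹ * (a ^ 2)⁻¹ = 1 at h3
    rw [mul_comm b a, mul_inv_cancel_right, pow_two, mul_inv_rev, mul_inv_cancel_left] at h3
    exact inv_eq_one.1 h3
  have h1 : Abelianization.of (PresentedGroup.of (rels := Set.range rels) (1 : Fin 5)) ^ 4 = 1 := by
    have h1 : PresentedGroup.mk (Set.range rels) (rels 0) = 1 :=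
      PresentedGroup.one_of_mem (rels := Set.range rels) ⟨0, rfl⟩
    have h2 : rels 0 = (.of 1) ^ 4 := rfl
    rw [h2] at h1
    have h3 := congrArg Abelianization.of h1
    simp only [map_pow, map_one] at h3
    exact h3
  refine ⟨rels, ?_, ?_, orderOf_dvd_of_pow_eq_one h1, 1, by norm_num, le_rfl, fun _ => 1,
    fun _ => le_rfl, ?_, by simp⟩
  · intro hc
    apply hund
    obtain ⟨c, hcc, e⟩ := ComputablePred.computable_iff.1 hc
    refine ComputablePred.computable_iff.2 ⟨fun n => c (F n), hcc.comp hF, ?_⟩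
    funext n
    rw [← congrFun e (F n)]
    exact propext ((hsm n).trans (hmain n).symm)
  · rw [h0, orderOf_one]; norm_num
  · intro i
    have : Fin.castLE (by norm_num : 1 ≤ 5) i = 0 := by
      ext; simp
    rw [this, h0, orderOf_one]
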